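/- arXiv:2104.02670 — 3 statements merged into one kernel-verified Lean document; each statement's English description precedes it below -/
import Mathlib

section
/- Let φ be a Drinfeld module of rank r over 𝕂, let x_1, …, x_r be a strict 𝔽_q-basis of φ[t], and let N ≥ 1 and ξ_1, …, ξ_r ∈ φ[t^N] satisfy, for each j: |ξ_j| < R_φ; φ_{t^{N−1}}(ξ_j) = x_j; and deg φ_{t^{N−1}}(ξ_j) > ⋯ > deg ξ_j. Write h_j := Σ_{m=0}^{N−1} φ_{t^{N−1−m}}(ξ_j) t^m = x_j + y_j t with y_j ∈ 𝕂[t], let B := (h_j^{(i−1)})_{1≤i,j≤r}, and let X := (x_j^{q^{i−1}})_{1≤i,j≤r}. Then: (1) det B = det X + y t for some y ∈ 𝕂[t] with Gauss norm ‖y‖ < |det X|; and (2) B ∈ GL_r(𝕋). -/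
open Filter

set_option maxHeartbeats 1000000
set_option synthInstance.maxHeartbeats 400000

noncomputable section

namespace DrinfeldRAT

variable (𝕂 : Type) [NontriviallyNormedField 𝕂]

/-- `deg x := log_q ‖x‖`. -/
def degK (q : ℕ) (x : 𝕂) : ℝ := Real.logb q ‖x‖

/-- The action of `φ_t` on `𝕂`: `φ_t(x) = θ x + A_1 x^q + ⋯ + A_r x^{q^r}`. -/
def phiT (q r : ℕ) (θ : 𝕂) (A : ℕ → 𝕂) (x : 𝕂) : 𝕂 :=
  θ * x + ∑ i ∈ Finset.Icc 1 r, A i * x ^ q ^ i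

/-- Membership in `N(φ) = {1 ≤ i ≤ r : A_i ≠ 0}`. -/
def inNphi (r : ℕ) (A : ℕ → 𝕂) (i : ℕ) : Prop := 1 ≤ i ∧ i ≤ r ∧ A i ≠ 0

/-- `μ_n = (deg A_n − q^n)/(q^n − 1)`. -/
def muPhi (q : ℕ) (A : ℕ → 𝕂) (n : ℕ) : ℝ :=
  (degK 𝕂 q (A n) - (q : ℝ) ^ n) / ((q : ℝ) ^ n - 1)

/-- `m` is the smallest index in `N(φ)` at which `μ` is maximal on `N(φ)`. -/
def IsMuIndex (q r : ℕ) (A : ℕ → 𝕂) (m : ℕ) : Prop :=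
  inNphi 𝕂 r A m ∧ (∀ i, inNphi 𝕂 r A i → muPhi 𝕂 q A i ≤ muPhi 𝕂 q A m) ∧
    ∀ m', inNphi 𝕂 r A m' → (∀ i, inNphi 𝕂 r A i → muPhi 𝕂 q A i ≤ muPhi 𝕂 q A m') → m ≤ m'

/-- `R_φ = q^{−μ_m}` (a real power). -/
def Rphi (q : ℕ) (A : ℕ → 𝕂) (m : ℕ) : ℝ := (q : ℝ) ^ (-(muPhi 𝕂 q A m))

/-- The coefficient of `x^{q^n}` in `φ_t(x)`, with `A₀ = θ`. -/
def Acoef (θ : 𝕂) (A : ℕ → 𝕂) (n : ℕ) : 𝕂 := if n = 0 then θ else A n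

/-- Data of the Newton polygon of `φ_t(x)`: vertices `(q^{d_j}, −deg A_{d_j})`,
`0 = d_0 < d_1 < ⋯ < d_s = r`, with strictly increasing edge slopes `λ_1 < ⋯ < λ_s`,
such that every point `(q^n, −deg A_n)` (for `A_n ≠ 0`, including `n = 0`) lies on or
above each edge line (lower convex hull). -/
structure NewtonData (q r : ℕ) (θ : 𝕂) (A : ℕ → 𝕂) where
  s : ℕ
  d : ℕ → ℕ
  lam : ℕ → ℝ
  s_pos : 0 < s
  d_zero : d 0 = 0
  d_last : d s = r
  d_mono : ∀ j < s, d j < d (j + 1)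
  vertex_ne : ∀ j, 1 ≤ j → j ≤ s → A (d j) ≠ 0
  slope_eq : ∀ j, 1 ≤ j → j ≤ s →
    lam j = (degK 𝕂 q (Acoef 𝕂 θ A (d (j - 1))) - degK 𝕂 q (Acoef 𝕂 θ A (d j))) /
      ((q : ℝ) ^ d j - (q : ℝ) ^ d (j - 1))
  lam_mono : ∀ j, 1 ≤ j → j + 1 ≤ s → lam j < lam (j + 1)
  hull : ∀ n ≤ r, Acoef 𝕂 θ A n ≠ 0 → ∀ j, 1 ≤ j → j ≤ s →
    lam j * ((q : ℝ) ^ n - (q : ℝ) ^ d j) + (-(degK 𝕂 q (Acoef 𝕂 θ A (d j)))) ≤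
      -(degK 𝕂 q (Acoef 𝕂 θ A n))

/-- `x 0, …, x (r−1)` is an `𝔽_q`-basis of `φ[t]` (`𝔽_q ⊆ 𝕂` is the set of `c` with `c^q = c`). -/
def IsFqBasis (q r : ℕ) (θ : 𝕂) (A : ℕ → 𝕂) (x : Fin r → 𝕂) : Prop :=
  (∀ j, phiT 𝕂 q r θ A (x j) = 0) ∧
    ∀ y, phiT 𝕂 q r θ A y = 0 →
      ∃! c : Fin r → 𝕂, (∀ j, c j ^ q = c j) ∧ y = ∑ j, c j * x j

/-- Strictness of a basis of `φ[t]` with respect to Newton polygon data: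
`deg x_j = λ_k` for `d_{k−1} < j ≤ d_k` (here `x` is indexed from `0`). -/
def IsStrict (q r : ℕ) (θ : 𝕂) (A : ℕ → 𝕂) (ND : NewtonData 𝕂 q r θ A)
    (x : Fin r → 𝕂) : Prop :=
  ∀ k, 1 ≤ k → k ≤ ND.s → ∀ j : Fin r, ND.d (k - 1) ≤ (j : ℕ) → (j : ℕ) < ND.d k →
    degK 𝕂 q (x j) = ND.lam k

/-- The conditions of Proposition `good-xi` on `ξ_1, …, ξ_r ∈ φ[t^N]`:
`|ξ_j| < R_φ`, `φ_{t^{N−1}}(ξ_j) = x_j`, and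
`deg φ_{t^{N−1}}(ξ_j) > ⋯ > deg φ_t(ξ_j) > deg ξ_j`. -/
def GoodXi (q r N : ℕ) (θ : 𝕂) (A : ℕ → 𝕂) (m : ℕ) (x ξ : Fin r → 𝕂) : Prop :=
  ∀ j, (phiT 𝕂 q r θ A)^[N] (ξ j) = 0 ∧
    ‖ξ j‖ < Rphi 𝕂 q A m ∧
    (phiT 𝕂 q r θ A)^[N - 1] (ξ j) = x j ∧
    ∀ i, i + 1 ≤ N - 1 →
      degK 𝕂 q ((phiT 𝕂 q r θ A)^[i] (ξ j)) < degK 𝕂 q ((phiT 𝕂 q r θ A)^[i + 1] (ξ j))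

/-- Gauss norm of a power series. -/
def gnorm (f : PowerSeries 𝕂) : ℝ := ⨆ i : ℕ, ‖PowerSeries.coeff i f‖

/-- Membership in the Tate algebra `𝕋`: coefficients tend to `0`. -/
def IsTate (f : PowerSeries 𝕂) : Prop :=
  Tendsto (fun i => ‖PowerSeries.coeff i f‖) atTop (nhds 0)

/-- `n`-th Frobenius twist of a power series: coefficients raised to the `q^n` power. -/
def twist (q n : ℕ) (f : PowerSeries 𝕂) : PowerSeries 𝕂 :=
  PowerSeries.mk fun i => PowerSeries.coeff i f ^ q ^ n

/-- Entrywise Frobenius twist of a matrix of power series. -/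
def twistM {r : ℕ} (q n : ℕ) (M : Matrix (Fin r) (Fin r) (PowerSeries 𝕂)) :
    Matrix (Fin r) (Fin r) (PowerSeries 𝕂) :=
  Matrix.of fun i j => twist 𝕂 q n (M i j)

/-- Gauss norm of a matrix: maximum of the Gauss norms of the entries. -/
def mnorm {r : ℕ} (M : Matrix (Fin r) (Fin r) (PowerSeries 𝕂)) : ℝ :=
  ⨆ p : Fin r × Fin r, gnorm 𝕂 (M p.1 p.2)

/-- Membership in `GL_r(𝕋)`: all entries in `𝕋` and two-sided inverse with entries in `𝕋`. -/
def MemGLT {r : ℕ} (M : Matrix (Fin r) (Fin r) (PowerSeries 𝕂)) : Prop :=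
  (∀ i j, IsTate 𝕂 (M i j)) ∧
    ∃ C : Matrix (Fin r) (Fin r) (PowerSeries 𝕂),
      (∀ i j, IsTate 𝕂 (C i j)) ∧ M * C = 1 ∧ C * M = 1

/-- The matrix `Θ`, with entries viewed in `𝕂[[t]]`. -/
def ThetaPS (r : ℕ) (θ : 𝕂) (A : ℕ → 𝕂) : Matrix (Fin r) (Fin r) (PowerSeries 𝕂) :=
  Matrix.of fun i j =>
    if (i : ℕ) + 1 < r then (if (j : ℕ) = (i : ℕ) + 1 then 1 else 0)
    else if (j : ℕ) = 0 then (PowerSeries.X - PowerSeries.C θ) * PowerSeries.C (A r)⁻¹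
    else -(PowerSeries.C (A (j : ℕ)) * PowerSeries.C (A r)⁻¹)

/-- `h = φ_{t^{N−1}}(ξ) + φ_{t^{N−2}}(ξ) t + ⋯ + ξ t^{N−1}` viewed in `𝕂[[t]]`. -/
def hPS (q r N : ℕ) (θ : 𝕂) (A : ℕ → 𝕂) (ξ : 𝕂) : PowerSeries 𝕂 :=
  ∑ mm ∈ Finset.range N, PowerSeries.C ((phiT 𝕂 q r θ A)^[N - 1 - mm] ξ) * PowerSeries.X ^ mm

/-- The matrix `B = (h_j^{(i−1)})`. -/
def BPS (q r N : ℕ) (θ : 𝕂) (A : ℕ → 𝕂) (ξ : Fin r → 𝕂) :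
    Matrix (Fin r) (Fin r) (PowerSeries 𝕂) :=
  Matrix.of fun i j => twist 𝕂 q (i : ℕ) (hPS 𝕂 q r N θ A (ξ j))

/-- Partial products `F F^{(1)} ⋯ F^{(n)}` (successive factors multiplied on the right). -/
def prodTwists {r : ℕ} (q : ℕ) (F : Matrix (Fin r) (Fin r) (PowerSeries 𝕂)) (n : ℕ) :
    Matrix (Fin r) (Fin r) (PowerSeries 𝕂) :=
  ((List.range (n + 1)).map fun k => twistM 𝕂 q k F).prod

/-- Convergence of a sequence of matrices with respect to the Gauss norm. -/
def MTendsto {r : ℕ} (g : ℕ → Matrix (Fin r) (Fin r) (PowerSeries 𝕂))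
    (P : Matrix (Fin r) (Fin r) (PowerSeries 𝕂)) : Prop :=
  Tendsto (fun n => mnorm 𝕂 (g n - P)) atTop (nhds 0)

/-- Shadowed partitions: `(S_1, …, S_r) ∈ P_r(n)` iff `S_i ⊆ {0, …, n−1}` and the translates
`S_i + j`, `0 ≤ j ≤ i−1`, partition `{0, …, n−1}` (here `S i` is the paper's `S_{i+1}`). -/
def IsShadow (r n : ℕ) (S : Fin r → Finset ℕ) : Prop :=
  (∀ i, S i ⊆ Finset.range n) ∧
    ∀ x ∈ Finset.range n, ∃! p : Fin r × ℕ, p.2 ≤ (p.1 : ℕ) ∧ ∃ y ∈ S p.1, x = y + p.2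

open Classical in
/-- The (finite) set `P_r(n)` of shadowed partitions. -/
def shadowFinset (r n : ℕ) : Finset (Fin r → Finset ℕ) :=
  (Fintype.piFinset fun _ : Fin r => (Finset.range n).powerset).filter (IsShadow r n)

/-- `𝓑_n(t)` as an element of `𝕂[[t]]` (expanded on the unit disk). -/
def BnPS (q r : ℕ) (θ : 𝕂) (A : ℕ → 𝕂) (n : ℕ) : PowerSeries 𝕂 :=
  ∑ S ∈ shadowFinset r n, ∏ i : Fin r, ∏ j ∈ S i,
    PowerSeries.C (A ((i : ℕ) + 1) ^ q ^ j) *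
      (PowerSeries.X - PowerSeries.C (θ ^ q ^ ((i : ℕ) + 1 + j)))⁻¹

/-- Partial sums of `ℒ_φ(ξ;t) = Σ_n 𝓑_n(t) ξ^{q^n}`. -/
def LPartial (q r : ℕ) (θ : 𝕂) (A : ℕ → 𝕂) (ξ : 𝕂) (n : ℕ) : PowerSeries 𝕂 :=
  ∑ k ∈ Finset.range (n + 1), BnPS 𝕂 q r θ A k * PowerSeries.C (ξ ^ q ^ k)

/-- The exponential function `exp_φ(z) = Σ α_n z^{q^n}`. -/
def expF (q : ℕ) (α : ℕ → 𝕂) (z : 𝕂) : 𝕂 := ∑' n : ℕ, α n * z ^ q ^ n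

/-- Anderson generating function `f_φ(u;t) = Σ_m exp_φ(u/θ^{m+1}) t^m`. -/
def AGF (q : ℕ) (α : ℕ → 𝕂) (θ u : 𝕂) : PowerSeries 𝕂 :=
  PowerSeries.mk fun mm => expF 𝕂 q α (u / θ ^ (mm + 1))

/-- The subring `A = 𝔽_q[θ]` of `𝕂`. -/
def Asubring (q : ℕ) (θ : 𝕂) : Subring 𝕂 :=
  Subring.closure ({θ} ∪ {c : 𝕂 | c ^ q = c})

/-- `π_1, …, π_r` is an `A`-basis of the period lattice `Λ_φ = ker exp_φ`. -/
def IsPeriodBasis (q r : ℕ) (α : ℕ → 𝕂) (θ : 𝕂) (π : Fin r → 𝕂) : Prop :=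
  (∀ j, expF 𝕂 q α (π j) = 0) ∧
    ∀ z, expF 𝕂 q α z = 0 →
      ∃! a : Fin r → 𝕂, (∀ j, a j ∈ Asubring 𝕂 q θ) ∧ z = ∑ j, a j * π j

/-- Frobenius twist on `𝕂(t)`, induced by a Frobenius endomorphism of `𝕂`. -/
def twistRF (frobq : 𝕂 →+* 𝕂) : RatFunc 𝕂 →+* RatFunc 𝕂 :=
  RatFunc.mapRingHom (Polynomial.mapRingHom frobq) (by
    intro pp hpp
    simp only [Submonoid.mem_comap, Polynomial.coe_mapRingHom]
    rw [mem_nonZeroDivisors_iff_ne_zero] at hpp ⊢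
    exact (Polynomial.map_ne_zero_iff frobq.injective).mpr hpp)

/-- Entrywise `n`-fold Frobenius twist of a matrix over `𝕂(t)`. -/
def twistMRF {r : ℕ} (frobq : 𝕂 →+* 𝕂) (n : ℕ)
    (M : Matrix (Fin r) (Fin r) (RatFunc 𝕂)) : Matrix (Fin r) (Fin r) (RatFunc 𝕂) :=
  Matrix.of fun i j => (fun g => twistRF 𝕂 frobq g)^[n] (M i j)

/-- The matrix `Θ`, with entries viewed in `𝕂(t)`. -/
def ThetaRF (r : ℕ) (θ : 𝕂) (A : ℕ → 𝕂) : Matrix (Fin r) (Fin r) (RatFunc 𝕂) :=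
  Matrix.of fun i j =>
    if (i : ℕ) + 1 < r then (if (j : ℕ) = (i : ℕ) + 1 then 1 else 0)
    else if (j : ℕ) = 0 then (RatFunc.X - RatFunc.C θ) / RatFunc.C (A r)
    else -(RatFunc.C (A (j : ℕ)) / RatFunc.C (A r))

/-- `h` as an element of `𝕂(t)`. -/
def hRF (q r N : ℕ) (θ : 𝕂) (A : ℕ → 𝕂) (ξ : 𝕂) : RatFunc 𝕂 :=
  ∑ mm ∈ Finset.range N, RatFunc.C ((phiT 𝕂 q r θ A)^[N - 1 - mm] ξ) * RatFunc.X ^ mm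

/-- The matrix `B = (h_j^{(i−1)})` over `𝕂(t)`. -/
def BRF (q r N : ℕ) (frobq : 𝕂 →+* 𝕂) (θ : 𝕂) (A : ℕ → 𝕂) (ξ : Fin r → 𝕂) :
    Matrix (Fin r) (Fin r) (RatFunc 𝕂) :=
  Matrix.of fun i j => (fun g => twistRF 𝕂 frobq g)^[(i : ℕ)] (hRF 𝕂 q r N θ A (ξ j))

/-- The matrix `W` with first row `(ξ_1, …, ξ_r)` and all other entries `0`. -/
def WRF (r : ℕ) (ξ : Fin r → 𝕂) : Matrix (Fin r) (Fin r) (RatFunc 𝕂) :=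
  Matrix.of fun i j => if (i : ℕ) = 0 then RatFunc.C (ξ j) else 0

/-- `R_0 = I/(t−θ)` and `R_m = Θ^{−1}(Θ^{−1})^{(1)} ⋯ (Θ^{−1})^{(m−1)}/(t−θ^{q^m})`. -/
def RmRF (r : ℕ) (frobq : 𝕂 →+* 𝕂) (q : ℕ) (θ : 𝕂) (A : ℕ → 𝕂) (mm : ℕ) :
    Matrix (Fin r) (Fin r) (RatFunc 𝕂) :=
  (RatFunc.X - RatFunc.C (θ ^ q ^ mm))⁻¹ •
    ((List.range mm).map fun k => twistMRF 𝕂 frobq k (ThetaRF 𝕂 r θ A)⁻¹).prod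

/-- `𝓑_n(t)` as an element of `𝕂(t)`. -/
def BnRF (q r : ℕ) (θ : 𝕂) (A : ℕ → 𝕂) (n : ℕ) : RatFunc 𝕂 :=
  ∑ S ∈ shadowFinset r n, ∏ i : Fin r, ∏ j ∈ S i,
    RatFunc.C (A ((i : ℕ) + 1) ^ q ^ j) / (RatFunc.X - RatFunc.C (θ ^ q ^ ((i : ℕ) + 1 + j)))

/-- `𝓑_n(t)` for integer `n`, with `𝓑_n = 0` for `n < 0`. -/
def BnRFZ (q r : ℕ) (θ : 𝕂) (A : ℕ → 𝕂) (n : ℤ) : RatFunc 𝕂 :=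
  if n < 0 then 0 else BnRF 𝕂 q r θ A n.toNat

/-- `F = B^{−1} Θ^{−1} B^{(1)}` over `𝕂(t)`. -/
def FRF (q r N : ℕ) (frobq : 𝕂 →+* 𝕂) (θ : 𝕂) (A : ℕ → 𝕂) (ξ : Fin r → 𝕂) :
    Matrix (Fin r) (Fin r) (RatFunc 𝕂) :=
  (BRF 𝕂 q r N frobq θ A ξ)⁻¹ * (ThetaRF 𝕂 r θ A)⁻¹ *
    twistMRF 𝕂 frobq 1 (BRF 𝕂 q r N frobq θ A ξ)

/-- `Π_n = B F F^{(1)} ⋯ F^{(n)}` over `𝕂(t)`. -/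
def PiNRF (q r N : ℕ) (frobq : 𝕂 →+* 𝕂) (θ : 𝕂) (A : ℕ → 𝕂) (ξ : Fin r → 𝕂) (n : ℕ) :
    Matrix (Fin r) (Fin r) (RatFunc 𝕂) :=
  BRF 𝕂 q r N frobq θ A ξ *
    ((List.range (n + 1)).map fun k => twistMRF 𝕂 frobq k (FRF 𝕂 q r N frobq θ A ξ)).prod

section helpers

variable {𝕂}

lemma usum_lt (hna : ∀ x y : 𝕂, ‖x + y‖ ≤ max ‖x‖ ‖y‖) {ι : Type*} (s : Finset ι) (f : ι → 𝕂)
    (b : ℝ) (hb : 0 < b) (h : ∀ i ∈ s, ‖f i‖ < b) : ‖∑ i ∈ s, f i‖ < b := by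
  classical
  induction s using Finset.induction_on with
  | empty => simpa using hb
  | insert a s ha ih =>
    rw [Finset.sum_insert ha]
    refine lt_of_le_of_lt (hna _ _) (max_lt (h a (by simp)) (ih ?_))
    intro i hi
    exact h i (by simp [hi])

lemma usum_le (hna : ∀ x y : 𝕂, ‖x + y‖ ≤ max ‖x‖ ‖y‖) {ι : Type*} (s : Finset ι) (f : ι → 𝕂)
    (b : ℝ) (hb : 0 ≤ b) (h : ∀ i ∈ s, ‖f i‖ ≤ b) : ‖∑ i ∈ s, f i‖ ≤ b := by
  classical
  induction s using Finset.induction_on with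
  | empty => simpa using hb
  | insert a s ha ih =>
    rw [Finset.sum_insert ha]
    refine le_trans (hna _ _) (max_le (h a (by simp)) (ih ?_))
    intro i hi
    exact h i (by simp [hi])

/-- Constant coefficient bounded by `b`, all higher coefficients strictly smaller. -/
def Dom (f : PowerSeries 𝕂) (b : ℝ) : Prop :=
  0 < b ∧ ‖PowerSeries.coeff 0 f‖ ≤ b ∧ ∀ n, 1 ≤ n → ‖PowerSeries.coeff n f‖ < b

lemma Dom.le {f : PowerSeries 𝕂} {b : ℝ} (h : Dom f b) (n : ℕ) : ‖PowerSeries.coeff n f‖ ≤ b := by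
  rcases Nat.eq_zero_or_pos n with rfl | hn
  · exact h.2.1
  · exact (h.2.2 n hn).le

lemma Dom.mono {f : PowerSeries 𝕂} {b c : ℝ} (h : Dom f b) (hbc : b ≤ c) : Dom f c :=
  ⟨h.1.trans_le hbc, h.2.1.trans hbc, fun n hn => (h.2.2 n hn).trans_le hbc⟩

lemma Dom.mul (hna : ∀ x y : 𝕂, ‖x + y‖ ≤ max ‖x‖ ‖y‖) {f g : PowerSeries 𝕂} {b c : ℝ}
    (hf : Dom f b) (hg : Dom g c) : Dom (f * g) (b * c) := by
  refine ⟨mul_pos hf.1 hg.1, ?_, ?_⟩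
  · rw [show PowerSeries.coeff 0 (f * g) = PowerSeries.coeff 0 f * PowerSeries.coeff 0 g by simp,
      norm_mul]
    exact mul_le_mul hf.2.1 hg.2.1 (norm_nonneg _) hf.1.le
  · intro n hn
    rw [PowerSeries.coeff_mul]
    refine usum_lt hna _ _ _ (mul_pos hf.1 hg.1) ?_
    rintro ⟨i, j⟩ hij
    rw [Finset.HasAntidiagonal.mem_antidiagonal] at hij
    simp only at hij ⊢
    rw [norm_mul]
    rcases Nat.eq_zero_or_pos i with rfl | hi
    · exact lt_of_le_of_lt (mul_le_mul_of_nonneg_right (hf.le _) (norm_nonneg _))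
        (mul_lt_mul_of_pos_left (hg.2.2 j (by omega)) hf.1)
    · exact lt_of_le_of_lt (mul_le_mul_of_nonneg_left (hg.le _) (norm_nonneg _))
        (mul_lt_mul_of_pos_right (hf.2.2 i hi) hg.1)

lemma Dom.one : Dom (1 : PowerSeries 𝕂) 1 := by
  refine ⟨one_pos, by simp, ?_⟩
  intro n hn
  rw [PowerSeries.coeff_one, if_neg (by omega)]
  simp

lemma Dom.prod (hna : ∀ x y : 𝕂, ‖x + y‖ ≤ max ‖x‖ ‖y‖) {ι : Type*} (s : Finset ι)
    (f : ι → PowerSeries 𝕂) (b : ι → ℝ) (h : ∀ i ∈ s, Dom (f i) (b i)) :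
    Dom (∏ i ∈ s, f i) (∏ i ∈ s, b i) := by
  classical
  induction s using Finset.induction_on with
  | empty => simpa using Dom.one
  | insert a s ha ih =>
    rw [Finset.prod_insert ha, Finset.prod_insert ha]
    exact Dom.mul hna (h a (by simp)) (ih fun i hi => h i (by simp [hi]))

lemma Dom.sum (hna : ∀ x y : 𝕂, ‖x + y‖ ≤ max ‖x‖ ‖y‖) {ι : Type*} (s : Finset ι)
    (f : ι → PowerSeries 𝕂) (b : ℝ) (hb : 0 < b) (h : ∀ i ∈ s, Dom (f i) b) :
    Dom (∑ i ∈ s, f i) b := by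
  refine ⟨hb, ?_, ?_⟩
  · rw [map_sum]
    exact usum_le hna _ _ _ hb.le fun i hi => (h i hi).2.1
  · intro n hn
    rw [map_sum]
    exact usum_lt hna _ _ _ hb fun i hi => (h i hi).2.2 n hn

lemma Dom.det (hna : ∀ x y : 𝕂, ‖x + y‖ ≤ max ‖x‖ ‖y‖) {r : ℕ}
    (M : Matrix (Fin r) (Fin r) (PowerSeries 𝕂)) (c : Fin r → Fin r → ℝ) (b : ℝ) (hb : 0 < b)
    (h : ∀ i j, Dom (M i j) (c i j))
    (hc : ∀ σ : Equiv.Perm (Fin r), ∏ j, c (σ j) j ≤ b) : Dom M.det b := by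
  rw [Matrix.det_apply']
  refine Dom.sum hna _ _ _ hb ?_
  intro σ _
  have h1 : Dom (∏ j, M (σ j) j) b := (Dom.prod hna _ _ _ fun j _ => h (σ j) j).mono (hc σ)
  rcases Int.units_eq_one_or (Equiv.Perm.sign σ) with hs | hs
  · simpa [hs] using h1
  · rw [hs]
    refine ⟨hb, ?_, ?_⟩
    · simpa using h1.2.1
    · intro n hn
      simpa using h1.2.2 n hn

/-- Polynomials inside power series. -/
def polyS (𝕂 : Type) [NontriviallyNormedField 𝕂] : Subring (PowerSeries 𝕂) :=
  (Polynomial.coeToPowerSeries.ringHom (R := 𝕂)).range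

lemma polyS_iff (f : PowerSeries 𝕂) :
    f ∈ polyS 𝕂 ↔ ∃ n0 : ℕ, ∀ k, n0 ≤ k → PowerSeries.coeff k f = 0 := by
  constructor
  · rintro ⟨P, rfl⟩
    refine ⟨P.natDegree + 1, fun k hk => ?_⟩
    simp only [Polynomial.coeToPowerSeries.ringHom_apply, Polynomial.coeff_coe]
    exact Polynomial.coeff_eq_zero_of_natDegree_lt (by omega)
  · rintro ⟨n0, h⟩
    refine ⟨PowerSeries.trunc n0 f, ?_⟩
    ext k
    simp only [Polynomial.coeToPowerSeries.ringHom_apply, Polynomial.coeff_coe,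
      PowerSeries.coeff_trunc]
    split_ifs with hk
    · rfl
    · exact (h k (by omega)).symm

lemma det_mem_polyS {r : ℕ} (M : Matrix (Fin r) (Fin r) (PowerSeries 𝕂))
    (h : ∀ i j, M i j ∈ polyS 𝕂) : M.det ∈ polyS 𝕂 := by
  rw [Matrix.det_apply']
  refine sum_mem fun σ _ => mul_mem ?_ (prod_mem fun j _ => h _ _)
  exact intCast_mem _ _

lemma adj_mem_polyS {r : ℕ} (M : Matrix (Fin r) (Fin r) (PowerSeries 𝕂))
    (h : ∀ i j, M i j ∈ polyS 𝕂) (i j : Fin r) : M.adjugate i j ∈ polyS 𝕂 := by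
  rw [Matrix.adjugate_apply]
  refine det_mem_polyS _ fun a b => ?_
  rw [Matrix.updateRow_apply]
  split_ifs
  · by_cases hb : b = i
    · subst hb; simp
    · simp [hb]
  · exact h _ _

lemma isTate_of_polyS {f : PowerSeries 𝕂} (h : f ∈ polyS 𝕂) : IsTate 𝕂 f := by
  obtain ⟨n0, h0⟩ := (polyS_iff f).1 h
  refine tendsto_const_nhds.congr' ?_
  filter_upwards [eventually_ge_atTop n0] with k hk
  simp [h0 k hk]

lemma IsTate.add {f g : PowerSeries 𝕂} (hf : IsTate 𝕂 f) (hg : IsTate 𝕂 g) :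
    IsTate 𝕂 (f + g) := by
  unfold IsTate at *
  have := hf.add hg
  rw [add_zero] at this
  refine squeeze_zero (fun _ => norm_nonneg _) (fun n => ?_) this
  rw [map_add]; exact norm_add_le _ _

lemma IsTate.poly_mul {f g : PowerSeries 𝕂} (hf : f ∈ polyS 𝕂) (hg : IsTate 𝕂 g) :
    IsTate 𝕂 (f * g) := by
  obtain ⟨P, rfl⟩ := hf
  simp only [Polynomial.coeToPowerSeries.ringHom_apply]
  induction P using Polynomial.induction_on' with
  | add P Q hP hQ =>
    rw [Polynomial.coe_add, add_mul]
    exact IsTate.add hP hQ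
  | monomial n a =>
    unfold IsTate at *
    rw [← tendsto_add_atTop_iff_nat n]
    have := hg.const_mul ‖a‖
    rw [mul_zero] at this
    refine this.congr fun k => ?_
    rw [Polynomial.coe_monomial, PowerSeries.monomial_eq_C_mul_X_pow, mul_assoc,
      PowerSeries.coeff_C_mul, PowerSeries.coeff_X_pow_mul, norm_mul]

lemma isTate_inv (hna : ∀ x y : 𝕂, ‖x + y‖ ≤ max ‖x‖ ‖y‖) {f : PowerSeries 𝕂}
    (hf : f ∈ polyS 𝕂) (h : Dom f ‖PowerSeries.constantCoeff f‖) :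
    f * f⁻¹ = 1 ∧ IsTate 𝕂 f⁻¹ := by
  have hD : PowerSeries.constantCoeff f ≠ 0 := norm_pos_iff.1 h.1
  refine ⟨PowerSeries.mul_inv_cancel f hD, ?_⟩
  set D := PowerSeries.constantCoeff f with hDdef
  obtain ⟨n0, h0⟩ := (polyS_iff f).1 hf
  -- choose `c < 1`
  obtain ⟨c, hc0, hc1, hc⟩ : ∃ c : ℝ, 0 < c ∧ c < 1 ∧
      ∀ i, 1 ≤ i → ‖PowerSeries.coeff i f‖ ≤ c ^ i * ‖D‖ := by
    have key : ∀ i : ℕ, 1 ≤ i →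
        ∀ᶠ c : ℝ in nhdsWithin 1 (Set.Iio 1), ‖PowerSeries.coeff i f‖ ≤ c ^ i * ‖D‖ := by
      intro i hi
      have ht : Tendsto (fun c : ℝ => c ^ i * ‖D‖) (nhdsWithin 1 (Set.Iio 1)) (nhds (1 ^ i * ‖D‖)) :=
        (Continuous.tendsto (by fun_prop) 1).mono_left nhdsWithin_le_nhds
      have := ht.eventually (lt_mem_nhds (a := ‖PowerSeries.coeff i f‖)
        (by simpa using h.2.2 i hi))
      exact this.mono fun _ h => h.le
    have hall : ∀ᶠ c : ℝ in nhdsWithin 1 (Set.Iio 1), ∀ i ∈ Finset.range n0, 1 ≤ i →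
        ‖PowerSeries.coeff i f‖ ≤ c ^ i * ‖D‖ := by
      rw [Finset.eventually_all]
      intro i _
      by_cases hi : 1 ≤ i
      · exact (key i hi).mono fun _ h _ => h
      · exact Eventually.of_forall fun _ h => absurd h hi
    have hpos : ∀ᶠ c : ℝ in nhdsWithin 1 (Set.Iio 1), 0 < c :=
      nhdsWithin_le_nhds (lt_mem_nhds one_pos)
    obtain ⟨c, ⟨h1, h2⟩, h3⟩ := ((hall.and hpos).and self_mem_nhdsWithin).exists
    refine ⟨c, h2, h3, fun i hi => ?_⟩
    by_cases hin : i < n0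
    · exact h1 i (by simpa using hin) hi
    · rw [h0 i (by omega)]; simp; positivity
  have hb : ∀ n, ‖PowerSeries.coeff n f⁻¹‖ ≤ c ^ n * ‖D‖⁻¹ := by
    intro n
    induction n using Nat.strong_induction_on with
    | _ n ih =>
      rw [PowerSeries.coeff_inv]
      split_ifs with hn
      · subst hn; simp [hDdef]
      · rw [norm_mul, norm_neg, norm_inv, mul_comm]
        refine mul_le_mul_of_nonneg_right ?_ (by positivity)
        refine usum_le hna _ _ _ (by positivity) ?_
        rintro ⟨i, j⟩ hij
        rw [Finset.HasAntidiagonal.mem_antidiagonal] at hij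
        simp only at hij ⊢
        split_ifs with hj
        · rw [norm_mul]
          calc _ ≤ (c ^ i * ‖D‖) * (c ^ j * ‖D‖⁻¹) :=
                mul_le_mul (hc i (by omega)) (ih j hj) (norm_nonneg _) (by positivity)
            _ = c ^ n := by
                rw [← hij, pow_add]
                have : ‖D‖ ≠ 0 := norm_ne_zero_iff.2 hD
                field_simp
        · simp; positivity
  have ht : Tendsto (fun n => c ^ n * ‖D‖⁻¹) atTop (nhds 0) := by
    simpa using (tendsto_pow_atTop_nhds_zero_of_lt_one hc0.le hc1).mul_const ‖D‖⁻¹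
  exact squeeze_zero (fun _ => norm_nonneg _) hb ht

end helpers

section helpers2

variable {𝕂}

lemma fq_finset [IsAlgClosed 𝕂] (p e q : ℕ) (hp : p.Prime) (hcharp : CharP 𝕂 p) (he : 0 < e)
    (hqpe : q = p ^ e) : ∃ F : Finset 𝕂, F.card = q ∧ ∀ c ∈ F, c ^ q = c := by
  classical
  have hq1 : 1 < q := by rw [hqpe]; exact Nat.one_lt_pow he.ne' hp.one_lt
  have hsep := galois_poly_separable (K := 𝕂) p q (by rw [hqpe]; exact dvd_pow_self p he.ne')
  have hcard := Polynomial.card_rootSet_eq_natDegree (K := 𝕂) hsep (IsAlgClosed.splits _)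
  rw [FiniteField.X_pow_card_sub_X_natDegree_eq _ hq1] at hcard
  refine ⟨((Polynomial.X ^ q - Polynomial.X : Polynomial 𝕂).rootSet 𝕂).toFinset, ?_, ?_⟩
  · rw [Set.toFinset_card]; exact hcard
  · intro c hc
    rw [Set.mem_toFinset, Polynomial.mem_rootSet] at hc
    have := hc.2
    simp at this
    exact sub_eq_zero.1 this

lemma moore_ne_zero [IsAlgClosed 𝕂] (p e q : ℕ) (hp : p.Prime) (hcharp : CharP 𝕂 p) (he : 0 < e)
    (hqpe : q = p ^ e) (r : ℕ) (x : Fin r → 𝕂)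
    (hinj : ∀ c : Fin r → 𝕂, (∀ j, c j ^ q = c j) → ∑ j, c j * x j = 0 → c = 0) :
    (Matrix.of fun i j : Fin r => x j ^ q ^ (i : ℕ)).det ≠ 0 := by
  classical
  have hq1 : 1 < q := by rw [hqpe]; exact Nat.one_lt_pow he.ne' hp.one_lt
  have : Fact p.Prime := ⟨hp⟩
  intro hdet
  obtain ⟨v, hv0, hv⟩ := Matrix.exists_vecMul_eq_zero_iff.2 hdet
  have hv' : ∀ j, ∑ i : Fin r, v i * x j ^ q ^ (i : ℕ) = 0 := fun j => congrFun hv j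
  obtain ⟨F, hFc, hF⟩ := fq_finset (𝕂 := 𝕂) p e q hp hcharp he hqpe
  set P : Polynomial 𝕂 := ∑ i : Fin r, Polynomial.C (v i) * Polynomial.X ^ (q ^ (i : ℕ)) with hP
  have hcoef : ∀ i : Fin r, P.coeff (q ^ (i : ℕ)) = v i := by
    intro i
    rw [hP, Polynomial.finsetSum_coeff, Finset.sum_eq_single i]
    · simp
    · intro k _ hk
      rw [Polynomial.coeff_C_mul_X_pow, if_neg]
      intro h
      exact hk (Fin.ext (Nat.pow_right_injective hq1 h).symm)
    · simp
  have hP0 : P ≠ 0 := by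
    intro h
    apply hv0
    funext i
    rw [← hcoef i, h]; simp
  have hdeg : P.natDegree < q ^ r := by
    have : P.degree < (q ^ r : ℕ) := by
      refine lt_of_le_of_lt (Polynomial.degree_sum_le _ _) ?_
      rw [Finset.sup_lt_iff (by exact_mod_cast WithBot.bot_lt_coe _)]
      intro i _
      refine lt_of_le_of_lt (Polynomial.degree_C_mul_X_pow_le _ _) ?_
      exact_mod_cast Nat.pow_lt_pow_right hq1 i.2
    exact (Polynomial.natDegree_lt_iff_degree_lt hP0).2 this
  have hpow : ∀ c : 𝕂, c ^ q = c → ∀ i : ℕ, c ^ q ^ i = c := by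
    intro c hc i
    induction i with
    | zero => simp
    | succ i ih => rw [pow_succ, pow_mul, ih, hc]
  have hroot : ∀ c : Fin r → 𝕂, (∀ j, c j ^ q = c j) → P.eval (∑ j, c j * x j) = 0 := by
    intro c hc
    rw [hP, Polynomial.eval_finsetSum]
    have : ∀ i : Fin r, Polynomial.eval (∑ j, c j * x j)
        (Polynomial.C (v i) * Polynomial.X ^ q ^ (i : ℕ))
        = ∑ j, c j * (v i * x j ^ q ^ (i : ℕ)) := by
      intro i
      rw [Polynomial.eval_mul, Polynomial.eval_C, Polynomial.eval_pow, Polynomial.eval_X]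
      have h2 : (∑ j, c j * x j) ^ q ^ (i : ℕ) = ∑ j, (c j * x j) ^ q ^ (i : ℕ) := by
        rw [hqpe, ← pow_mul]
        exact sum_pow_char_pow p _ _ _
      rw [h2, Finset.mul_sum]
      refine Finset.sum_congr rfl fun j _ => ?_
      rw [mul_pow, hpow _ (hc j)]
      ring
    simp_rw [this]
    rw [Finset.sum_comm]
    refine Finset.sum_eq_zero fun j _ => ?_
    rw [← Finset.mul_sum, hv' j, mul_zero]
  have hle : (Fintype.piFinset fun _ : Fin r => F).card ≤ P.roots.toFinset.card := by
    refine Finset.card_le_card_of_injOn (fun c => ∑ j, c j * x j) ?_ ?_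
    · intro c hc
      have hc' : ∀ j, c j ∈ F := by simpa using hc
      simp only [Finset.mem_coe, Multiset.mem_toFinset, Polynomial.mem_roots hP0,
        Polynomial.IsRoot.def]
      exact hroot c fun j => hF _ (hc' j)
    · intro c hc c' hc' heq
      have h1 : ∀ j, c j ∈ F := by simpa using hc
      have h2 : ∀ j, c' j ∈ F := by simpa using hc'
      simp only at heq
      have := hinj (c - c') (fun j => ?_) ?_
      · exact sub_eq_zero.1 this
      · have h3 : (c j - c' j) ^ q = c j ^ q - c' j ^ q := by
          rw [hqpe]; exact sub_pow_char_pow (p := p) (c j) (c' j) e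
        rw [Pi.sub_apply, h3, hF _ (h1 j), hF _ (h2 j)]
      · simp only [Pi.sub_apply, sub_mul, Finset.sum_sub_distrib]
        rw [heq, sub_self]
  rw [Fintype.card_piFinset] at hle
  simp only [hFc, Finset.prod_const, Finset.card_univ, Fintype.card_fin] at hle
  have := (Multiset.toFinset_card_le P.roots).trans (Polynomial.card_roots' P)
  omega

lemma moore_norm (p e q : ℕ) (hp : p.Prime) (hcharp : CharP 𝕂 p)
    (hqpe : q = p ^ e) (r : ℕ) (hr : 0 < r) (θ : 𝕂) (A : ℕ → 𝕂) (hAr : A r ≠ 0) (x : Fin r → 𝕂)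
    (hx : ∀ j, phiT 𝕂 q r θ A (x j) = 0) :
    ‖(Matrix.of fun i j : Fin r => x j ^ q ^ (i : ℕ)).det‖ ^ q = ‖θ‖ / ‖A r‖ *
      ‖(Matrix.of fun i j : Fin r => x j ^ q ^ (i : ℕ)).det‖ := by
  have : Fact p.Prime := ⟨hp⟩
  obtain ⟨n, rfl⟩ : ∃ n, r = n + 1 := ⟨r - 1, by omega⟩
  set X := (Matrix.of fun i j : Fin (n + 1) => x j ^ q ^ (i : ℕ)) with hX
  set T : Matrix (Fin (n + 1)) (Fin (n + 1)) 𝕂 := Matrix.of fun i j =>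
    if i = Fin.last n then -(Acoef 𝕂 θ A j / A (n + 1)) else if (j : ℕ) = i + 1 then 1 else 0
    with hT
  have h1 : X.det ^ q = (X.map (fun a => a ^ q)).det := by
    have h := RingHom.map_det (iterateFrobenius 𝕂 p e) X
    simp only [iterateFrobenius_def, ← hqpe] at h
    rw [h]
    congr 1
    ext i j
    simp [iterateFrobenius_def, ← hqpe]
  have h2 : X.map (fun a => a ^ q) = T * X := by
    ext i j
    rw [Matrix.map_apply, Matrix.mul_apply]
    by_cases hi : i = Fin.last n
    · subst hi
      have hj := hx j
      unfold phiT at hj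
      rw [Finset.sum_Icc_succ_top (by omega)] at hj
      have h3 : ∑ k : Fin (n + 1), Acoef 𝕂 θ A k * x j ^ q ^ (k : ℕ) =
          θ * x j + ∑ i ∈ Finset.Icc 1 n, A i * x j ^ q ^ i := by
        rw [Fin.sum_univ_eq_sum_range (fun k => Acoef 𝕂 θ A k * x j ^ q ^ k),
          Finset.sum_range_succ', add_comm]
        congr 1
        · simp [Acoef]
        · rw [Finset.range_eq_Ico, Finset.sum_Ico_add' (fun k => Acoef 𝕂 θ A k * x j ^ q ^ k)]
          refine Finset.sum_congr (by ext; simp) ?_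
          intro k hk
          have : k ≠ 0 := by simp at hk; omega
          simp [Acoef, this]
      have h4 : ∑ k : Fin (n + 1), T (Fin.last n) k * X k j =
          -(∑ k : Fin (n + 1), Acoef 𝕂 θ A k * x j ^ q ^ (k : ℕ)) / A (n + 1) := by
        rw [neg_div, Finset.sum_div, ← Finset.sum_neg_distrib]
        refine Finset.sum_congr rfl fun k _ => ?_
        simp [hT, hX]
        ring
      rw [h4, h3, eq_div_iff hAr, eq_neg_iff_add_eq_zero]
      simp only [hX, Matrix.of_apply, Fin.val_last, ← pow_mul, ← pow_succ]
      linear_combination hj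
    · have hi' : (i : ℕ) + 1 < n + 1 := by
        have := i.2
        have : (i : ℕ) ≠ n := fun h => hi (Fin.ext h)
        omega
      rw [Finset.sum_eq_single (⟨i + 1, hi'⟩ : Fin (n + 1))]
      · simp [hT, hX, hi, ← pow_mul, ← pow_succ]
      · intro k _ hk
        have : (k : ℕ) ≠ i + 1 := fun h => hk (Fin.ext h)
        simp [hT, hi, this]
      · simp
  have h5 : ‖T.det‖ = ‖θ‖ / ‖A (n + 1)‖ := by
    rw [Matrix.det_succ_column_zero, Finset.sum_eq_single (Fin.last n)]
    · have : T.submatrix (Fin.last n).succAbove Fin.succ = 1 := by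
        ext i j
        rw [Matrix.submatrix_apply, Fin.succAbove_last, Matrix.one_apply]
        have : Fin.castSucc i ≠ Fin.last n := (Fin.castSucc_lt_last i).ne
        rw [hT, Matrix.of_apply, if_neg this]
        simp [Fin.ext_iff, eq_comm]
      rw [this]
      simp [hT, Acoef]
    · intro i _ hi
      simp [hT, hi]
    · simp
  rw [← norm_pow, h1, h2, Matrix.det_mul, norm_mul, h5]

lemma ND_mono {q r : ℕ} {θ : 𝕂} {A : ℕ → 𝕂} (ND : NewtonData 𝕂 q r θ A) (i k : ℕ)
    (hik : i ≤ k) (hk : k ≤ ND.s) : ND.d i ≤ ND.d k := by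
  induction k, hik using Nat.le_induction with
  | base => exact le_rfl
  | succ k hik ih => exact (ih (by omega)).trans (ND.d_mono k (by omega)).le

lemma ND_lam_mono {q r : ℕ} {θ : 𝕂} {A : ℕ → 𝕂} (ND : NewtonData 𝕂 q r θ A) (i k : ℕ)
    (hi : 1 ≤ i) (hik : i ≤ k) (hk : k ≤ ND.s) : ND.lam i ≤ ND.lam k := by
  induction k, hik using Nat.le_induction with
  | base => exact le_rfl
  | succ k hik ih => exact (ih (by omega)).trans (ND.lam_mono k (by omega) (by omega)).le

lemma ND_find {q r : ℕ} {θ : 𝕂} {A : ℕ → 𝕂} (ND : NewtonData 𝕂 q r θ A) (j : ℕ) (hj : j < r) :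
    ∃ k, 1 ≤ k ∧ k ≤ ND.s ∧ ND.d (k - 1) ≤ j ∧ j < ND.d k := by
  classical
  have hex : ∃ k, j < ND.d k := ⟨ND.s, by rw [ND.d_last]; exact hj⟩
  refine ⟨Nat.find hex, ?_, Nat.find_min' hex (by rw [ND.d_last]; exact hj), ?_, Nat.find_spec hex⟩
  · rw [Nat.one_le_iff_ne_zero]
    intro h
    have := Nat.find_spec hex
    rw [h, ND.d_zero] at this
    omega
  · by_contra hlt
    push Not at hlt
    have h1 := Nat.find_min' hex hlt
    have h2 : Nat.find hex ≠ 0 := by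
      intro h
      have := Nat.find_spec hex
      rw [h, ND.d_zero] at this
      omega
    omega

lemma strict_mono {q r : ℕ} {θ : 𝕂} {A : ℕ → 𝕂} (ND : NewtonData 𝕂 q r θ A) (x : Fin r → 𝕂)
    (hxs : IsStrict 𝕂 q r θ A ND x) : Monotone fun j => degK 𝕂 q (x j) := by
  intro i j hij
  obtain ⟨k, hk1, hk2, hk3, hk4⟩ := ND_find ND i i.2
  obtain ⟨l, hl1, hl2, hl3, hl4⟩ := ND_find ND j j.2
  simp only
  rw [hxs k hk1 hk2 i hk3 hk4, hxs l hl1 hl2 j hl3 hl4]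
  refine ND_lam_mono ND k l hk1 ?_ hl2
  by_contra hlt
  push Not at hlt
  have := ND_mono ND l (k - 1) (by omega) (by omega)
  have : (i : ℕ) ≤ j := hij
  omega

lemma strict_sum {q r : ℕ} (hq : 1 < q) (hr : 0 < r) {θ : 𝕂} {A : ℕ → 𝕂}
    (ND : NewtonData 𝕂 q r θ A)
    (x : Fin r → 𝕂) (hxs : IsStrict 𝕂 q r θ A ND x) :
    ((q : ℝ) - 1) * ∑ j : Fin r, (q : ℝ) ^ (j : ℕ) * degK 𝕂 q (x j) =
      degK 𝕂 q θ - degK 𝕂 q (A r) := by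
  set g : ℕ → ℝ := fun j => if h : j < r then degK 𝕂 q (x ⟨j, h⟩) else 0 with hg
  have hq' : (1 : ℝ) < q := by exact_mod_cast hq
  have main : ∀ k, k ≤ ND.s → ((q : ℝ) - 1) * ∑ j ∈ Finset.range (ND.d k), (q : ℝ) ^ j * g j =
      degK 𝕂 q θ - degK 𝕂 q (Acoef 𝕂 θ A (ND.d k)) := by
    intro k
    induction k with
    | zero => intro _; simp [ND.d_zero, Acoef]
    | succ k ih =>
      intro hk
      have hlt := ND.d_mono k (by omega)
      have hle : ND.d (k + 1) ≤ r := (ND_mono ND _ _ hk le_rfl).trans ND.d_last.le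
      rw [← Finset.sum_range_add_sum_Ico _ hlt.le, mul_add, ih (by omega)]
      have h1 : ∑ j ∈ Finset.Ico (ND.d k) (ND.d (k + 1)), (q : ℝ) ^ j * g j =
          (∑ j ∈ Finset.Ico (ND.d k) (ND.d (k + 1)), (q : ℝ) ^ j) * ND.lam (k + 1) := by
        rw [Finset.sum_mul]
        refine Finset.sum_congr rfl fun j hj => ?_
        rw [Finset.mem_Ico] at hj
        have hjr : j < r := by omega
        rw [hg]
        simp only [hjr, dite_true]
        rw [hxs (k + 1) (by omega) hk ⟨j, hjr⟩ (by simpa using hj.1) hj.2]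
      rw [h1, geom_sum_Ico hq'.ne' hlt.le, ND.slope_eq (k + 1) (by omega) hk]
      have h2 : (q : ℝ) ^ ND.d (k + 1) - (q : ℝ) ^ ND.d (k + 1 - 1) ≠ 0 := by
        rw [Nat.add_sub_cancel]
        exact (sub_pos.2 (pow_lt_pow_right₀ hq' hlt)).ne'
      rw [Nat.add_sub_cancel] at h2 ⊢
      have h3 : (q : ℝ) - 1 ≠ 0 := by linarith
      field_simp
      ring
  have := main ND.s le_rfl
  rw [ND.d_last] at this
  rw [← Fin.sum_univ_eq_sum_range (fun j => (q : ℝ) ^ j * g j)] at this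
  have h5 : Acoef 𝕂 θ A r = A r := by simp [Acoef, hr.ne']
  rw [h5] at this
  rw [← this]
  congr 1
  refine Finset.sum_congr rfl fun j _ => ?_
  simp [hg]

end helpers2

theorem stmt15
    (𝕂 : Type) [NontriviallyNormedField 𝕂] [CompleteSpace 𝕂] [IsAlgClosed 𝕂]
    (hna : ∀ x y : 𝕂, ‖x + y‖ ≤ max ‖x‖ ‖y‖)
    (p e q : ℕ) (hp : p.Prime) (hcharp : CharP 𝕂 p) (he : 0 < e) (hqpe : q = p ^ e)
    (θ : 𝕂) (hθ : ‖θ‖ = (q : ℝ))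
    (r : ℕ) (hr : 0 < r) (A : ℕ → 𝕂) (hAr : A r ≠ 0)
    (ND : NewtonData 𝕂 q r θ A)
    (m : ℕ) (hm : IsMuIndex 𝕂 q r A m)
    (x : Fin r → 𝕂) (hxb : IsFqBasis 𝕂 q r θ A x) (hxs : IsStrict 𝕂 q r θ A ND x)
    (N : ℕ) (hN : 1 ≤ N) (ξ : Fin r → 𝕂) (hξ : GoodXi 𝕂 q r N θ A m x ξ)
    :
    (∃ y : PowerSeries 𝕂, (∃ n0 : ℕ, ∀ k, n0 ≤ k → PowerSeries.coeff k y = 0) ∧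
      (BPS 𝕂 q r N θ A ξ).det =
        PowerSeries.C (Matrix.of fun i j : Fin r => x j ^ q ^ (i : ℕ)).det +
          PowerSeries.X * y ∧
      gnorm 𝕂 y < ‖(Matrix.of fun i j : Fin r => x j ^ q ^ (i : ℕ)).det‖) ∧
    MemGLT 𝕂 (BPS 𝕂 q r N θ A ξ) := by
  have hq1 : 1 < q := by rw [hqpe]; exact Nat.one_lt_pow he.ne' hp.one_lt
  have hq' : (1 : ℝ) < q := by exact_mod_cast hq1
  have hq0 : q ≠ 0 := by omega
  set D := (Matrix.of fun i j : Fin r => x j ^ q ^ (i : ℕ)).det with hDdef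
  have hφ0 : phiT 𝕂 q r θ A 0 = 0 := by
    unfold phiT
    rw [mul_zero, zero_add]
    refine Finset.sum_eq_zero fun i _ => ?_
    rw [zero_pow (pow_ne_zero _ hq0), mul_zero]
  -- independence
  have hinj : ∀ c : Fin r → 𝕂, (∀ j, c j ^ q = c j) → ∑ j, c j * x j = 0 → c = 0 := by
    intro c hc h0
    refine (hxb.2 0 hφ0).unique ⟨hc, h0.symm⟩ ⟨fun j => ?_, ?_⟩
    · simp [hq0]
    · simp
  have hx0 : ∀ j, x j ≠ 0 := by
    intro j hj
    have := hinj (Pi.single j 1) (fun k => ?_) ?_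
    · have h1 := congrFun this j
      simp at h1
    · by_cases hk : k = j
      · subst hk; simp
      · simp [hk, hq0]
    · rw [Finset.sum_eq_single j]
      · simp [hj]
      · intro k _ hk
        simp [hk]
      · simp
  have hD0 : D ≠ 0 := moore_ne_zero p e q hp hcharp he hqpe r x hinj
  have hθ0 : θ ≠ 0 := by
    rw [← norm_pos_iff, hθ]; linarith
  -- norm of `D`
  have hDn : ‖D‖ = ∏ j : Fin r, ‖x j‖ ^ q ^ (j : ℕ) := by
    have h1 := moore_norm p e q hp hcharp hqpe r hr θ A hAr x hxb.1
    rw [← hDdef] at h1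
    have h2 := strict_sum hq1 hr ND x hxs
    have hDp : 0 < ‖D‖ := norm_pos_iff.2 hD0
    have hprod : 0 < ∏ j : Fin r, ‖x j‖ ^ q ^ (j : ℕ) :=
      Finset.prod_pos fun j _ => pow_pos (norm_pos_iff.2 (hx0 j)) _
    have h3 : ((q : ℝ) - 1) * Real.logb q ‖D‖ = degK 𝕂 q θ - degK 𝕂 q (A r) := by
      have h4 := congrArg (Real.logb q) h1
      rw [Real.logb_pow, Real.logb_mul
        (div_ne_zero (norm_ne_zero_iff.2 hθ0) (norm_ne_zero_iff.2 hAr)) hDp.ne',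
        Real.logb_div (norm_ne_zero_iff.2 hθ0) (norm_ne_zero_iff.2 hAr)] at h4
      unfold degK
      linarith
    have h5 : Real.logb q (∏ j : Fin r, ‖x j‖ ^ q ^ (j : ℕ)) =
        ∑ j : Fin r, (q : ℝ) ^ (j : ℕ) * degK 𝕂 q (x j) := by
      rw [Real.logb_prod _ _ fun j _ => (pow_pos (norm_pos_iff.2 (hx0 j)) _).ne']
      refine Finset.sum_congr rfl fun j _ => ?_
      rw [Real.logb_pow]
      unfold degK
      push_cast
      rfl
    have h6 : Real.logb q ‖D‖ = Real.logb q (∏ j : Fin r, ‖x j‖ ^ q ^ (j : ℕ)) := by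
      rw [h5]
      exact mul_left_cancel₀ (by linarith : (q : ℝ) - 1 ≠ 0) (h3.trans h2.symm)
    exact Real.logb_injOn_pos hq' hDp hprod h6
  -- rearrangement
  have hperm : ∀ σ : Equiv.Perm (Fin r), ∏ j, ‖x j‖ ^ q ^ ((σ j : Fin r) : ℕ) ≤ ‖D‖ := by
    intro σ
    rw [hDn]
    have hp1 : ∀ τ : Equiv.Perm (Fin r), 0 < ∏ j, ‖x j‖ ^ q ^ ((τ j : Fin r) : ℕ) :=
      fun τ => Finset.prod_pos fun j _ => pow_pos (norm_pos_iff.2 (hx0 j)) _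
    have hlog : ∀ τ : Equiv.Perm (Fin r),
        Real.logb q (∏ j, ‖x j‖ ^ q ^ ((τ j : Fin r) : ℕ)) =
        ∑ j, (q : ℝ) ^ ((τ j : Fin r) : ℕ) * degK 𝕂 q (x j) := by
      intro τ
      rw [Real.logb_prod _ _ fun j _ => (pow_pos (norm_pos_iff.2 (hx0 j)) _).ne']
      refine Finset.sum_congr rfl fun j _ => ?_
      rw [Real.logb_pow]
      unfold degK
      push_cast
      rfl
    have hl1 := hlog σ
    have hl2 := hlog 1
    have hpp := hp1 1
    simp only [Equiv.Perm.coe_one, id_eq] at hl2 hpp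
    rw [← Real.logb_le_logb hq' (hp1 σ) hpp, hl1, hl2]
    have hmv : Monovary (fun j : Fin r => (q : ℝ) ^ (j : ℕ)) (fun j => degK 𝕂 q (x j)) := by
      refine Monotone.monovary (fun i j hij => ?_) (strict_mono ND x hxs)
      exact pow_le_pow_right₀ hq'.le hij
    exact hmv.sum_comp_perm_mul_le_sum_mul (σ := σ)
  -- coefficients of `h`
  have hcoef : ∀ j k, PowerSeries.coeff k (hPS 𝕂 q r N θ A (ξ j)) =
      if k < N then (phiT 𝕂 q r θ A)^[N - 1 - k] (ξ j) else 0 := by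
    intro j k
    unfold hPS
    rw [map_sum]
    simp_rw [PowerSeries.coeff_C_mul, PowerSeries.coeff_X_pow]
    simp
  have hit0 : ∀ k, (phiT 𝕂 q r θ A)^[k] 0 = 0 := fun k => Function.iterate_fixed hφ0 k
  have hne : ∀ j i, i ≤ N - 1 → (phiT 𝕂 q r θ A)^[i] (ξ j) ≠ 0 := by
    intro j i hi h0
    have h1 := (hξ j).2.2.1
    rw [show N - 1 = (N - 1 - i) + i by omega, Function.iterate_add_apply, h0, hit0] at h1
    exact hx0 j h1.symm
  have hstep : ∀ j i, i + 1 ≤ N - 1 →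
      ‖(phiT 𝕂 q r θ A)^[i] (ξ j)‖ < ‖(phiT 𝕂 q r θ A)^[i + 1] (ξ j)‖ := by
    intro j i hi
    have h1 := (hξ j).2.2.2 i hi
    unfold degK at h1
    rwa [Real.logb_lt_logb_iff hq' (norm_pos_iff.2 (hne j i (by omega)))
      (norm_pos_iff.2 (hne j (i + 1) hi))] at h1
  have hlt : ∀ j k, 1 ≤ k → k ≤ N - 1 →
      ‖(phiT 𝕂 q r θ A)^[N - 1 - k] (ξ j)‖ < ‖x j‖ := by
    intro j k hk
    induction k, hk using Nat.le_induction with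
    | base =>
      intro hk
      have := hstep j (N - 1 - 1) (by omega)
      rwa [show N - 1 - 1 + 1 = N - 1 by omega, (hξ j).2.2.1] at this
    | succ k hk ih =>
      intro hk'
      have := hstep j (N - 1 - (k + 1)) (by omega)
      rw [show N - 1 - (k + 1) + 1 = N - 1 - k by omega] at this
      exact this.trans (ih (by omega))
  have hBcoef : ∀ i j k, PowerSeries.coeff k (BPS 𝕂 q r N θ A ξ i j) =
      PowerSeries.coeff k (hPS 𝕂 q r N θ A (ξ j)) ^ q ^ (i : ℕ) := by
    intro i j k
    simp [BPS, twist]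
  have hB0 : ∀ i j, PowerSeries.coeff 0 (BPS 𝕂 q r N θ A ξ i j) = x j ^ q ^ (i : ℕ) := by
    intro i j
    rw [hBcoef, hcoef, if_pos (by omega), Nat.sub_zero, (hξ j).2.2.1]
  have hDom : ∀ i j, Dom (BPS 𝕂 q r N θ A ξ i j) (‖x j‖ ^ q ^ (i : ℕ)) := by
    intro i j
    refine ⟨pow_pos (norm_pos_iff.2 (hx0 j)) _, ?_, ?_⟩
    · rw [hB0, norm_pow]
    · intro n hn
      rw [hBcoef, hcoef, norm_pow]
      refine pow_lt_pow_left₀ ?_ (norm_nonneg _) (pow_ne_zero _ hq0)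
      split_ifs with h
      · exact hlt j n hn (by omega)
      · simpa using hx0 j
  have hpoly : ∀ i j, BPS 𝕂 q r N θ A ξ i j ∈ polyS 𝕂 := by
    intro i j
    rw [polyS_iff]
    refine ⟨N, fun k hk => ?_⟩
    rw [hBcoef, hcoef, if_neg (by omega), zero_pow (pow_ne_zero _ hq0)]
  have hdet : Dom (BPS 𝕂 q r N θ A ξ).det ‖D‖ :=
    Dom.det hna _ (fun i j => ‖x j‖ ^ q ^ (i : ℕ)) _ (norm_pos_iff.2 hD0) hDom hperm
  have hdpoly := det_mem_polyS _ hpoly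
  have hconst : PowerSeries.constantCoeff (BPS 𝕂 q r N θ A ξ).det = D := by
    rw [RingHom.map_det, hDdef]
    congr 1
    ext i j
    simpa using hB0 i j
  obtain ⟨n0, hn0⟩ := (polyS_iff _).1 hdpoly
  refine ⟨⟨PowerSeries.mk fun k => PowerSeries.coeff (k + 1) (BPS 𝕂 q r N θ A ξ).det,
    ⟨n0, fun k hk => ?_⟩, ?_, ?_⟩, ?_⟩
  · rw [PowerSeries.coeff_mk]
    exact hn0 _ (by omega)
  · ext k
    rcases k with _ | k
    · simp [hconst]
    · simp [PowerSeries.coeff_succ_X_mul, PowerSeries.coeff_C]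
  · unfold gnorm
    simp only [PowerSeries.coeff_mk]
    obtain ⟨k0, _, hk0⟩ := Finset.exists_max_image (Finset.range (n0 + 1))
      (fun k => ‖PowerSeries.coeff (k + 1) (BPS 𝕂 q r N θ A ξ).det‖) ⟨0, by simp⟩
    refine lt_of_le_of_lt (ciSup_le fun k => ?_) (hdet.2.2 (k0 + 1) (by omega))
    by_cases hk : k < n0 + 1
    · exact hk0 k (by simpa using hk)
    · rw [hn0 (k + 1) (by omega), norm_zero]
      exact norm_nonneg _
  · refine ⟨fun i j => isTate_of_polyS (hpoly i j), ?_⟩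
    rw [← hconst] at hdet
    obtain ⟨hinv, hT⟩ := isTate_inv hna hdpoly hdet
    have hMC : BPS 𝕂 q r N θ A ξ * ((BPS 𝕂 q r N θ A ξ).det⁻¹ • (BPS 𝕂 q r N θ A ξ).adjugate)
        = 1 := by
      rw [Matrix.mul_smul, Matrix.mul_adjugate, smul_smul, mul_comm, hinv, one_smul]
    refine ⟨(BPS 𝕂 q r N θ A ξ).det⁻¹ • (BPS 𝕂 q r N θ A ξ).adjugate, fun i j => ?_, hMC,
      mul_eq_one_comm.1 hMC⟩
    rw [Matrix.smul_apply, smul_eq_mul, mul_comm]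
    exact IsTate.poly_mul (adj_mem_polyS _ hpoly i j) hT

end DrinfeldRAT
end
end

section
/- Let φ be a Drinfeld module of rank r over 𝕂, let x_1, …, x_r be a strict 𝔽_q-basis of φ[t], let N ≥ 1 and ξ_1, …, ξ_r ∈ φ[t^N] satisfy, for each j: |ξ_j| < R_φ; φ_{t^{N−1}}(ξ_j) = x_j; and deg φ_{t^{N−1}}(ξ_j) > ⋯ > deg ξ_j; and let h_j := Σ_{m=0}^{N−1} φ_{t^{N−1−m}}(ξ_j) t^m, B := (h_j^{(i−1)}). Set F := B^{−1} Θ^{−1} B^{(1)}, and for n ≥ 0 set Π_n := B F F^{(1)} ⋯ F^{(n)}. Let W be the r×r matrix with first row (ξ_1, …, ξ_r) and all other entries 0, and define R_0 := I/(t−θ) and R_m := Θ^{−1} (Θ^{−1})^{(1)} ⋯ (Θ^{−1})^{(m−1)} / (t − θ^{q^m}) for m ≥ 1. Then for every n ≥ 0, Π_n = B − t^N · Σ_{m=0}^n R_m W^{(m)}, as matrices with entries in 𝕂(t). -/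
open Filter

set_option maxHeartbeats 1000000
set_option synthInstance.maxHeartbeats 400000

noncomputable section

namespace DrinfeldRAT

variable (𝕂 : Type) [NontriviallyNormedField 𝕂]

section Helpers

variable {𝕂}

lemma twistMRF_eq {r : ℕ} (frobq : 𝕂 →+* 𝕂) (n : ℕ)
    (M : Matrix (Fin r) (Fin r) (RatFunc 𝕂)) :
    twistMRF 𝕂 frobq n M = ((twistRF 𝕂 frobq) ^ n).mapMatrix M := by
  ext i j
  simp [twistMRF, RingHom.coe_pow]

lemma twistRF_algebraMap (frobq : 𝕂 →+* 𝕂) (P : Polynomial 𝕂) :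
    twistRF 𝕂 frobq (algebraMap _ _ P) = algebraMap _ _ (P.map frobq) := by
  have := RatFunc.map_apply_div (Polynomial.mapRingHom frobq)
    (by
      intro pp hpp
      simp only [Submonoid.mem_comap, Polynomial.coe_mapRingHom]
      rw [mem_nonZeroDivisors_iff_ne_zero] at hpp ⊢
      exact (Polynomial.map_ne_zero_iff frobq.injective).mpr hpp) P 1
  rw [twistRF, RatFunc.coe_mapRingHom_eq_coe_map]
  simpa using this

lemma twistRF_pow_algebraMap (frobq : 𝕂 →+* 𝕂) (n : ℕ) (P : Polynomial 𝕂) :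
    ((twistRF 𝕂 frobq) ^ n) (algebraMap _ _ P) = algebraMap _ _ (P.map (frobq ^ n)) := by
  induction n with
  | zero => simp [RingHom.one_def]
  | succ n ih =>
    rw [pow_succ', pow_succ', RingHom.mul_def, RingHom.comp_apply, ih, twistRF_algebraMap,
      Polynomial.map_map, RingHom.mul_def]

lemma twistRF_pow_C (frobq : 𝕂 →+* 𝕂) (n : ℕ) (c : 𝕂) :
    ((twistRF 𝕂 frobq) ^ n) (RatFunc.C c) = RatFunc.C ((frobq ^ n) c) := by
  rw [← RatFunc.algebraMap_C, twistRF_pow_algebraMap, Polynomial.map_C, RatFunc.algebraMap_C]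

lemma twistRF_pow_X (frobq : 𝕂 →+* 𝕂) (n : ℕ) :
    ((twistRF 𝕂 frobq) ^ n) RatFunc.X = RatFunc.X := by
  rw [← RatFunc.algebraMap_X, twistRF_pow_algebraMap, Polynomial.map_X]

lemma frob_pow (q : ℕ) (frobq : 𝕂 →+* 𝕂) (hfrob : ∀ c : 𝕂, frobq c = c ^ q) (n : ℕ) (c : 𝕂) :
    (frobq ^ n) c = c ^ q ^ n := by
  induction n with
  | zero => simp
  | succ n ih =>
    rw [pow_succ', RingHom.mul_def, RingHom.comp_apply, ih, hfrob, ← pow_mul, pow_succ]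

/-- polynomial version of `h` -/
def hPoly (q r N : ℕ) (θ : 𝕂) (A : ℕ → 𝕂) (ξ : 𝕂) : Polynomial 𝕂 :=
  ∑ mm ∈ Finset.range N, Polynomial.C ((phiT 𝕂 q r θ A)^[N - 1 - mm] ξ) * Polynomial.X ^ mm

lemma hRF_eq (q r N : ℕ) (θ : 𝕂) (A : ℕ → 𝕂) (ξ : 𝕂) :
    hRF 𝕂 q r N θ A ξ = algebraMap _ _ (hPoly q r N θ A ξ) := by
  simp [hRF, hPoly, map_sum]

lemma hPoly_eval (q r N : ℕ) (hN : 1 ≤ N) (θ : 𝕂) (A : ℕ → 𝕂) (ξ : 𝕂) :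
    (hPoly q r N θ A ξ).coeff 0 = (phiT 𝕂 q r θ A)^[N - 1] ξ := by
  obtain ⟨N, rfl⟩ : ∃ k, N = k + 1 := ⟨N - 1, by omega⟩
  simp [Finset.sum_range_succ', hPoly]

/-- the key functional equation of `h` -/
lemma h_fun (q r N : ℕ) (hN : 1 ≤ N) (frobq : 𝕂 →+* 𝕂) (hfrob : ∀ c : 𝕂, frobq c = c ^ q)
    (θ : 𝕂) (A : ℕ → 𝕂) (ξ : 𝕂) (h0 : (phiT 𝕂 q r θ A)^[N] ξ = 0) :
    RatFunc.C θ * hRF 𝕂 q r N θ A ξ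
      + ∑ i ∈ Finset.Icc 1 r, RatFunc.C (A i) * ((twistRF 𝕂 frobq) ^ i) (hRF 𝕂 q r N θ A ξ)
      = RatFunc.X * hRF 𝕂 q r N θ A ξ - RatFunc.C ξ * RatFunc.X ^ N := by
  obtain ⟨N, rfl⟩ : ∃ k, N = k + 1 := ⟨N - 1, by omega⟩
  have h1 : RatFunc.C θ * hRF 𝕂 q r (N+1) θ A ξ
      + ∑ i ∈ Finset.Icc 1 r, RatFunc.C (A i) * ((twistRF 𝕂 frobq) ^ i) (hRF 𝕂 q r (N+1) θ A ξ)
      = ∑ mm ∈ Finset.range (N+1),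
        RatFunc.C ((phiT 𝕂 q r θ A)^[N + 1 - mm] ξ) * RatFunc.X ^ mm := by
    simp only [hRF, map_sum, map_mul, map_pow, twistRF_pow_C, twistRF_pow_X, Finset.mul_sum,
      frob_pow q frobq hfrob]
    rw [Finset.sum_comm, ← Finset.sum_add_distrib]
    refine Finset.sum_congr rfl fun k hk => ?_
    have hk' : N + 1 - k = (N + 1 - 1 - k) + 1 := by
      have := Finset.mem_range.1 hk
      omega
    rw [hk', Function.iterate_succ_apply', phiT]
    simp only [map_add, map_mul, map_sum, map_pow, add_mul, Finset.sum_mul, mul_assoc]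
  rw [h1, Finset.sum_range_succ']
  simp only [hRF]
  rw [Finset.sum_range_succ]
  simp only [Nat.sub_zero, h0, map_zero, zero_mul, add_zero, Nat.add_sub_cancel, Nat.sub_self,
    Function.iterate_zero, id]
  rw [mul_add, Finset.mul_sum]
  have : ∑ k ∈ Finset.range N, RatFunc.C ((phiT 𝕂 q r θ A)^[N + 1 - (k + 1)] ξ) *
      (RatFunc.X : RatFunc 𝕂) ^ (k + 1)
    = ∑ i ∈ Finset.range N, RatFunc.X * (RatFunc.C ((phiT 𝕂 q r θ A)^[N - i] ξ) *
      RatFunc.X ^ i) := by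
    refine Finset.sum_congr rfl fun k hk => ?_
    rw [Nat.add_sub_add_right]
    ring
  rw [this]
  ring

lemma RX_sub_C_ne (θ : 𝕂) : (RatFunc.X - RatFunc.C θ : RatFunc 𝕂) ≠ 0 := by
  rw [← RatFunc.algebraMap_X, ← RatFunc.algebraMap_C, ← map_sub]
  exact RatFunc.algebraMap_ne_zero (Polynomial.X_sub_C_ne_zero θ)

lemma Theta_det (r : ℕ) (hr : 0 < r) (θ : 𝕂) (A : ℕ → 𝕂) (hAr : A r ≠ 0) :
    (ThetaRF 𝕂 r θ A).det ≠ 0 := by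
  intro hdet
  obtain ⟨v, hv, hv0⟩ := Matrix.exists_mulVec_eq_zero_iff.2 hdet
  apply hv
  obtain ⟨r, rfl⟩ : ∃ k, r = k + 1 := ⟨r - 1, by omega⟩
  have hs : ∀ i : Fin r, v i.succ = 0 := by
    intro i
    have := congrFun hv0 i.castSucc
    rw [Matrix.mulVec, dotProduct, Finset.sum_eq_single i.succ] at this
    · simpa [ThetaRF] using this
    · intro b _ hb
      have : (b : ℕ) ≠ i + 1 := fun h => hb (Fin.ext (by simpa using h))
      simp [ThetaRF, this]
    · simp
  have h0 : v 0 = 0 := by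
    have := congrFun hv0 (Fin.last r)
    rw [Matrix.mulVec, dotProduct, Fin.sum_univ_succ] at this
    simp only [hs, mul_zero, Finset.sum_const_zero, add_zero] at this
    simpa [ThetaRF, RX_sub_C_ne, hAr] using this
  funext i
  refine Fin.cases h0 hs i

lemma Theta_B (q r N : ℕ) (hr : 0 < r) (hN : 1 ≤ N) (frobq : 𝕂 →+* 𝕂)
    (hfrob : ∀ c : 𝕂, frobq c = c ^ q)
    (θ : 𝕂) (A : ℕ → 𝕂) (hAr : A r ≠ 0) (ξ : Fin r → 𝕂)
    (h0 : ∀ j, (phiT 𝕂 q r θ A)^[N] (ξ j) = 0) :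
    ThetaRF 𝕂 r θ A * (BRF 𝕂 q r N frobq θ A ξ -
      (RatFunc.X ^ N * (RatFunc.X - RatFunc.C θ)⁻¹ : RatFunc 𝕂) • WRF 𝕂 r ξ) =
      twistMRF 𝕂 frobq 1 (BRF 𝕂 q r N frobq θ A ξ) := by
  obtain ⟨r, rfl⟩ : ∃ k, r = k + 1 := ⟨r - 1, by omega⟩
  have hB : ∀ i j, BRF 𝕂 q (r+1) N frobq θ A ξ i j =
      ((twistRF 𝕂 frobq) ^ (i : ℕ)) (hRF 𝕂 q (r+1) N θ A (ξ j)) := by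
    intro i j
    simp [BRF, RingHom.coe_pow]
  ext i j
  rw [twistMRF_eq, RingHom.mapMatrix_apply, Matrix.map_apply, hB, Matrix.mul_apply]
  have hpow : ((twistRF 𝕂 frobq) ^ 1) (((twistRF 𝕂 frobq) ^ (i : ℕ))
      (hRF 𝕂 q (r+1) N θ A (ξ j))) = ((twistRF 𝕂 frobq) ^ ((i : ℕ) + 1))
      (hRF 𝕂 q (r+1) N θ A (ξ j)) := by
    rw [add_comm (i : ℕ) 1, pow_add]; rfl
  rw [hpow]
  simp only [Matrix.sub_apply, Matrix.smul_apply, hB]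
  refine Fin.lastCases ?_ (fun i => ?_) i
  · have hf := h_fun q (r+1) N hN frobq hfrob θ A (ξ j) (h0 j)
    rw [Finset.sum_Icc_succ_top (by omega)] at hf
    have hsum : ∑ i ∈ Finset.Icc 1 r, RatFunc.C (A i) *
        ((twistRF 𝕂 frobq) ^ i) (hRF 𝕂 q (r+1) N θ A (ξ j)) =
        ∑ i : Fin r, RatFunc.C (A (i + 1)) *
        ((twistRF 𝕂 frobq) ^ ((i : ℕ) + 1)) (hRF 𝕂 q (r+1) N θ A (ξ j)) := by
      rw [Fin.sum_univ_eq_sum_range (fun i => RatFunc.C (A (i + 1)) *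
        ((twistRF 𝕂 frobq) ^ (i + 1)) (hRF 𝕂 q (r+1) N θ A (ξ j))), Finset.range_eq_Ico,
        Finset.sum_Ico_add' (fun i => RatFunc.C (A i) *
        ((twistRF 𝕂 frobq) ^ i) (hRF 𝕂 q (r+1) N θ A (ξ j)))]
      rfl
    rw [hsum] at hf
    rw [Fin.sum_univ_succ]
    have hA : (RatFunc.C (A (r+1)) : RatFunc 𝕂) ≠ 0 := by simpa using hAr
    have hX := RX_sub_C_ne θ
    have hrest : ∀ i : Fin r, ThetaRF 𝕂 (r+1) θ A (Fin.last r) i.succ *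
        (((twistRF 𝕂 frobq) ^ ((i.succ : Fin (r+1)) : ℕ)) (hRF 𝕂 q (r+1) N θ A (ξ j)) -
        (RatFunc.X ^ N * (RatFunc.X - RatFunc.C θ)⁻¹ : RatFunc 𝕂) • WRF 𝕂 (r+1) ξ i.succ j)
        = -(RatFunc.C (A (r+1)))⁻¹ * (RatFunc.C (A (i + 1)) *
        ((twistRF 𝕂 frobq) ^ ((i : ℕ) + 1)) (hRF 𝕂 q (r+1) N θ A (ξ j))) := by
      intro i
      simp [ThetaRF, WRF]
      ring
    simp only [hrest, ← Finset.mul_sum]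
    have hT0 : ThetaRF 𝕂 (r+1) θ A (Fin.last r) 0 =
      (RatFunc.X - RatFunc.C θ) / RatFunc.C (A (r+1)) := by simp [ThetaRF]
    have hW0 : WRF 𝕂 (r+1) ξ 0 j = RatFunc.C (ξ j) := by simp [WRF]
    rw [hT0, hW0]
    simp only [Fin.val_zero, pow_zero, RingHom.one_def, RingHom.id_apply, Fin.val_last,
      smul_eq_mul]
    generalize (∑ i : Fin r, RatFunc.C (A (i + 1)) *
        ((twistRF 𝕂 frobq) ^ ((i : ℕ) + 1)) (hRF 𝕂 q (r+1) N θ A (ξ j))) = S at *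
    generalize ((twistRF 𝕂 frobq) ^ (r + 1)) (hRF 𝕂 q (r+1) N θ A (ξ j)) = T at *
    field_simp
    linear_combination -hf
  · rw [Finset.sum_eq_single i.succ]
    · simp [ThetaRF, WRF]
    · intro b _ hb
      have : (b : ℕ) ≠ i + 1 := fun h => hb (Fin.ext (by simpa using h))
      simp [ThetaRF, this]
    · simp

/-- Nonvanishing of the Moore determinant. -/
lemma moore_det [IsAlgClosed 𝕂] (p e q : ℕ) (hp : p.Prime) (hcharp : CharP 𝕂 p)
    (he : 0 < e) (hqpe : q = p ^ e)
    (θ : 𝕂) (hθ : θ ≠ 0)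
    (r : ℕ) (hr : 0 < r) (A : ℕ → 𝕂) (hAr : A r ≠ 0)
    (frobq : 𝕂 →+* 𝕂) (hfrob : ∀ c : 𝕂, frobq c = c ^ q)
    (x : Fin r → 𝕂) (hxb : IsFqBasis 𝕂 q r θ A x) :
    (Matrix.of fun i j : Fin r => x j ^ q ^ (i : ℕ)).det ≠ 0 := by
  intro hdet
  have hq1 : 1 < q := by
    rw [hqpe]; exact Nat.one_lt_pow he.ne' hp.one_lt
  have hq0 : (q : 𝕂) = 0 := by
    rw [hqpe, Nat.cast_pow, CharP.cast_eq_zero, zero_pow he.ne']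
  obtain ⟨a, ha, ha0⟩ := Matrix.exists_vecMul_eq_zero_iff.2 hdet
  apply ha
  let P : Polynomial 𝕂 := ∑ i : Fin r, Polynomial.C (a i) * Polynomial.X ^ q ^ (i : ℕ)
  let Q : Polynomial 𝕂 := Polynomial.C θ * Polynomial.X +
    ∑ i ∈ Finset.Icc 1 r, Polynomial.C (A i) * Polynomial.X ^ q ^ i
  have hQeval : ∀ y, Q.eval y = phiT 𝕂 q r θ A y := by
    intro y
    simp [Q, phiT, Polynomial.eval_finsetSum]
  have hQder : Q.derivative = Polynomial.C θ := by
    have : ∀ i ∈ Finset.Icc 1 r, (Polynomial.derivative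
        (Polynomial.C (A i) * Polynomial.X ^ q ^ i) : Polynomial 𝕂) = 0 := by
      intro i hi
      have : i ≠ 0 := by have := Finset.mem_Icc.1 hi; omega
      rw [Polynomial.derivative_C_mul, Polynomial.derivative_X_pow]
      simp [hq0, this]
    simp only [Q, Polynomial.derivative_add, Polynomial.derivative_sum]
    rw [Finset.sum_eq_zero this]
    simp
  have hsep : Q.Separable := by
    rw [Polynomial.separable_def, hQder]
    exact (isCoprime_one_right).of_isCoprime_of_dvd_right
      (Polynomial.isUnit_C.2 hθ.isUnit).dvd
  have hQc : Q.coeff (q ^ r) = A r := by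
    simp only [Q, Polynomial.coeff_add, Polynomial.finsetSum_coeff, Polynomial.coeff_C_mul,
      Polynomial.coeff_X_pow, Polynomial.coeff_X]
    rw [Finset.sum_eq_single r]
    · have : (1 : ℕ) ≠ q ^ r := (Nat.one_lt_pow hr.ne' hq1).ne
      simp [this]
    · intro b _ hb
      have : q ^ r ≠ q ^ b := fun h => hb (Nat.pow_right_injective hq1 h).symm
      simp [this]
    · intro h; exact absurd (Finset.mem_Icc.2 ⟨hr, le_rfl⟩) h
  have hdvd : Q ∣ P := by
    have hQ0 : Q ≠ 0 := hsep.ne_zero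
    have hsp := IsAlgClosed.splits Q
    by_cases hP0 : P = 0
    · rw [hP0]; exact dvd_zero _
    apply hsp.dvd_of_roots_le_roots hQ0
    rw [Multiset.le_iff_subset (Polynomial.nodup_roots hsep)]
    intro y hy
    rw [Polynomial.mem_roots hQ0, Polynomial.IsRoot, hQeval] at hy
    rw [Polynomial.mem_roots hP0, Polynomial.IsRoot]
    obtain ⟨c, ⟨hc, rfl⟩, -⟩ := hxb.2 y hy
    have hc' : ∀ i j, (frobq ^ i) (c j) = c j := by
      intro i j
      induction i with
      | zero => simp
      | succ n ih => rw [pow_succ', RingHom.mul_def, RingHom.comp_apply, ih, hfrob, hc]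
    simp only [P, Polynomial.eval_finsetSum, Polynomial.eval_mul, Polynomial.eval_C,
      Polynomial.eval_pow, Polynomial.eval_X]
    have : ∀ i : ℕ, (∑ j, c j * x j) ^ q ^ i = ∑ j, c j * x j ^ q ^ i := by
      intro i
      rw [← frob_pow q frobq hfrob, map_sum]
      refine Finset.sum_congr rfl fun j _ => ?_
      rw [map_mul, hc', frob_pow q frobq hfrob]
    simp only [this, Finset.mul_sum]
    rw [Finset.sum_comm]
    refine Finset.sum_eq_zero fun j _ => ?_
    have h := congrFun ha0 j
    simp only [Matrix.vecMul, dotProduct, Matrix.of_apply, Pi.zero_apply] at h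
    calc _ = c j * ∑ i, a i * x j ^ q ^ (i : ℕ) := by
          rw [Finset.mul_sum]; exact Finset.sum_congr rfl fun i _ => by ring
      _ = 0 := by rw [h, mul_zero]
  have hPdeg : P.degree < (q ^ r : ℕ) := by
    refine (Polynomial.degree_sum_le _ _).trans_lt ?_
    rw [Finset.sup_lt_iff (WithBot.bot_lt_coe _)]
    intro i _
    refine (Polynomial.degree_C_mul_X_pow_le _ _).trans_lt ?_
    exact_mod_cast Nat.pow_lt_pow_right hq1 i.2
  have hP0 : P = 0 := by
    refine Polynomial.eq_zero_of_dvd_of_degree_lt hdvd (hPdeg.trans_le ?_)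
    exact Polynomial.le_degree_of_ne_zero (by rw [hQc]; exact hAr)
  funext k
  have : P.coeff (q ^ (k : ℕ)) = a k := by
    simp only [P, Polynomial.finsetSum_coeff, Polynomial.coeff_C_mul, Polynomial.coeff_X_pow]
    rw [Finset.sum_eq_single k]
    · simp
    · intro b _ hb
      have : q ^ (k : ℕ) ≠ q ^ (b : ℕ) :=
        fun h => hb (Fin.ext (Nat.pow_right_injective hq1 h).symm)
      simp [this]
    · simp
  rw [← this, hP0]; simp

lemma B_det (q r N : ℕ) (hN : 1 ≤ N) (θ : 𝕂) (A : ℕ → 𝕂)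
    (frobq : 𝕂 →+* 𝕂) (hfrob : ∀ c : 𝕂, frobq c = c ^ q)
    (x ξ : Fin r → 𝕂) (hx : ∀ j, (phiT 𝕂 q r θ A)^[N - 1] (ξ j) = x j)
    (hM : (Matrix.of fun i j : Fin r => x j ^ q ^ (i : ℕ)).det ≠ 0) :
    (BRF 𝕂 q r N frobq θ A ξ).det ≠ 0 := by
  let B' : Matrix (Fin r) (Fin r) (Polynomial 𝕂) :=
    Matrix.of fun i j => (hPoly q r N θ A (ξ j)).map (frobq ^ (i : ℕ))
  have hB : BRF 𝕂 q r N frobq θ A ξ = (algebraMap (Polynomial 𝕂) (RatFunc 𝕂)).mapMatrix B' := by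
    ext i j
    simp only [BRF, Matrix.of_apply, RingHom.mapMatrix_apply, Matrix.map_apply, B',
      ← twistRF_pow_algebraMap, ← hRF_eq, RingHom.coe_pow]
  have hB0 : (Polynomial.constantCoeff).mapMatrix B' =
      Matrix.of fun i j : Fin r => x j ^ q ^ (i : ℕ) := by
    ext i j
    simp only [B', Matrix.of_apply, RingHom.mapMatrix_apply, Matrix.map_apply,
      Polynomial.constantCoeff_apply, Polynomial.coeff_map, hPoly_eval q r N hN, hx,
      frob_pow q frobq hfrob]
  rw [hB, ← RingHom.map_det]
  apply RatFunc.algebraMap_ne_zero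
  intro h
  apply hM
  rw [← hB0, ← RingHom.map_det, h, map_zero]

end Helpers

theorem stmt16
    (𝕂 : Type) [NontriviallyNormedField 𝕂] [CompleteSpace 𝕂] [IsAlgClosed 𝕂]
    (hna : ∀ x y : 𝕂, ‖x + y‖ ≤ max ‖x‖ ‖y‖)
    (p e q : ℕ) (hp : p.Prime) (hcharp : CharP 𝕂 p) (he : 0 < e) (hqpe : q = p ^ e)
    (θ : 𝕂) (hθ : ‖θ‖ = (q : ℝ))
    (r : ℕ) (hr : 0 < r) (A : ℕ → 𝕂) (hAr : A r ≠ 0)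
    (frobq : 𝕂 →+* 𝕂) (hfrob : ∀ c : 𝕂, frobq c = c ^ q)
    (ND : NewtonData 𝕂 q r θ A)
    (m : ℕ) (hm : IsMuIndex 𝕂 q r A m)
    (x : Fin r → 𝕂) (hxb : IsFqBasis 𝕂 q r θ A x) (hxs : IsStrict 𝕂 q r θ A ND x)
    (N : ℕ) (hN : 1 ≤ N) (ξ : Fin r → 𝕂) (hξ : GoodXi 𝕂 q r N θ A m x ξ)
    :
    ∀ n : ℕ, PiNRF 𝕂 q r N frobq θ A ξ n =
      BRF 𝕂 q r N frobq θ A ξ -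
        (RatFunc.X : RatFunc 𝕂) ^ N • ∑ k ∈ Finset.range (n + 1),
          RmRF 𝕂 r frobq q θ A k * twistMRF 𝕂 frobq k (WRF 𝕂 r ξ) := by
  have hq1 : 1 < q := by
    rw [hqpe]; exact Nat.one_lt_pow he.ne' hp.one_lt
  have hθ0 : θ ≠ 0 := by
    rintro rfl
    rw [norm_zero] at hθ
    have : (q : ℝ) ≠ 0 := by exact_mod_cast (by omega : q ≠ 0)
    exact this hθ.symm
  have hMoore := moore_det p e q hp hcharp he hqpe θ hθ0 r hr A hAr frobq hfrob x hxb
  have hBdet := B_det q r N hN θ A frobq hfrob x ξ (fun j => (hξ j).2.2.1) hMoore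
  have hTB := Theta_B q r N hr hN frobq hfrob θ A hAr ξ (fun j => (hξ j).1)
  have hTdet := Theta_det r hr θ A hAr
  simp only [PiNRF, RmRF, FRF]
  generalize BRF 𝕂 q r N frobq θ A ξ = B at *
  generalize ThetaRF 𝕂 r θ A = T at *
  have hBB : B * B⁻¹ = 1 := Matrix.mul_nonsing_inv _ (isUnit_iff_ne_zero.2 hBdet)
  have hTT : T⁻¹ * T = 1 := Matrix.nonsing_inv_mul _ (isUnit_iff_ne_zero.2 hTdet)
  have hTB' : T⁻¹ * twistMRF 𝕂 frobq 1 B = B -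
      (RatFunc.X ^ N * (RatFunc.X - RatFunc.C θ)⁻¹ : RatFunc 𝕂) • WRF 𝕂 r ξ := by
    rw [← hTB, ← Matrix.mul_assoc, hTT, Matrix.one_mul]
  have htele : ∀ n : ℕ, B * ((List.range n).map fun k => twistMRF 𝕂 frobq k
      (B⁻¹ * T⁻¹ * twistMRF 𝕂 frobq 1 B)).prod =
      ((List.range n).map fun k => twistMRF 𝕂 frobq k T⁻¹).prod * twistMRF 𝕂 frobq n B := by
    intro n
    induction n with
    | zero => simp [twistMRF_eq, RingHom.one_def]
    | succ n ih =>
      rw [List.range_succ, List.map_append, List.map_append, List.prod_append, List.prod_append,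
        ← Matrix.mul_assoc, ih]
      simp only [List.map_cons, List.map_nil, List.prod_cons, List.prod_nil, mul_one]
      have h1 : twistMRF 𝕂 frobq n B * twistMRF 𝕂 frobq n (B⁻¹ * T⁻¹ * twistMRF 𝕂 frobq 1 B)
          = twistMRF 𝕂 frobq n T⁻¹ * twistMRF 𝕂 frobq (n + 1) B := by
        have h2 : twistMRF 𝕂 frobq (n + 1) B = twistMRF 𝕂 frobq n (twistMRF 𝕂 frobq 1 B) := by
          simp only [twistMRF_eq]
          ext i j
          simp only [RingHom.mapMatrix_apply, Matrix.map_apply]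
          rw [pow_add]; rfl
        rw [h2]
        simp only [twistMRF_eq frobq n]
        rw [← map_mul, ← map_mul, ← Matrix.mul_assoc, ← Matrix.mul_assoc, hBB, Matrix.one_mul]
      rw [Matrix.mul_assoc, h1, Matrix.mul_assoc]
  have hstep : ∀ n : ℕ, twistMRF 𝕂 frobq n T⁻¹ * twistMRF 𝕂 frobq (n + 1) B =
      twistMRF 𝕂 frobq n B - (RatFunc.X ^ N * (RatFunc.X - RatFunc.C (θ ^ q ^ n))⁻¹ : RatFunc 𝕂) •
        twistMRF 𝕂 frobq n (WRF 𝕂 r ξ) := by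
    intro n
    have h2 : twistMRF 𝕂 frobq (n + 1) B = twistMRF 𝕂 frobq n (twistMRF 𝕂 frobq 1 B) := by
      simp only [twistMRF_eq]
      ext i j
      simp only [RingHom.mapMatrix_apply, Matrix.map_apply]
      rw [pow_add]; rfl
    rw [h2]
    simp only [twistMRF_eq frobq n]
    rw [← map_mul, hTB', map_sub]
    congr 1
    ext i j
    simp only [RingHom.mapMatrix_apply, Matrix.map_apply, Matrix.smul_apply, smul_eq_mul, map_mul,
      map_pow, map_inv₀, map_sub, twistRF_pow_X, twistRF_pow_C, frob_pow q frobq hfrob]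
  intro n
  rw [htele]
  have main : ∀ n : ℕ, ((List.range n).map fun k => twistMRF 𝕂 frobq k T⁻¹).prod *
      twistMRF 𝕂 frobq n B = B - (RatFunc.X : RatFunc 𝕂) ^ N • ∑ k ∈ Finset.range n,
        ((RatFunc.X - RatFunc.C (θ ^ q ^ k))⁻¹ •
          ((List.range k).map fun k => twistMRF 𝕂 frobq k T⁻¹).prod) *
          twistMRF 𝕂 frobq k (WRF 𝕂 r ξ) := by
    intro n
    induction n with
    | zero => simp [twistMRF_eq, RingHom.one_def]
    | succ n ih =>
      rw [List.range_succ, List.map_append, List.prod_append, Finset.sum_range_succ, smul_add,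
        ← sub_sub, ← ih]
      simp only [List.map_cons, List.map_nil, List.prod_cons, List.prod_nil, mul_one]
      rw [Matrix.mul_assoc, hstep, Matrix.mul_sub, Matrix.mul_smul, Matrix.smul_mul, smul_smul]
  exact main (n + 1)

end DrinfeldRAT
end
end

section
/- Let F ∈ Mat_r(𝕋) satisfy ‖F − I‖ < 1, where I is the r×r identity matrix. Then: (1) for every n ≥ 0, ‖F^{(n)} − I‖ = ‖F − I‖^{q^n}, so ‖F^{(n)} − I‖ → 0 as n → ∞; (2) the infinite product ∏_{n=0}^∞ F^{(n)} = F F^{(1)} F^{(2)} ⋯, in which each successive factor is multiplied on the right, converges in Mat_r(𝕋) with respect to the Gauss norm; and (3) the limit lies in GL_r(𝕋), i.e., its determinant is a unit of 𝕋. -/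
open Filter

set_option maxHeartbeats 1000000
set_option synthInstance.maxHeartbeats 400000

noncomputable section

namespace DrinfeldRAT

variable (𝕂 : Type) [NontriviallyNormedField 𝕂]

/-- All coefficients of all entries are bounded by `c`. -/
def MB {𝕂 : Type} [NontriviallyNormedField 𝕂] {r : ℕ} (c : ℝ)
    (M : Matrix (Fin r) (Fin r) (PowerSeries 𝕂)) : Prop :=
  ∀ i j k, ‖PowerSeries.coeff k (M i j)‖ ≤ c

/-- Matrices with Tate entries. -/
def MT {𝕂 : Type} [NontriviallyNormedField 𝕂] {r : ℕ}
    (M : Matrix (Fin r) (Fin r) (PowerSeries 𝕂)) : Prop :=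
  ∀ i j, IsTate 𝕂 (M i j)

section helpers

variable {𝕂 : Type} [NontriviallyNormedField 𝕂] {r : ℕ}

theorem isTate_iff (f : PowerSeries 𝕂) : IsTate 𝕂 f ↔ PowerSeries.IsRestricted 1 f := by
  rw [PowerSeries.isRestricted_iff']
  simp [IsTate]

theorem MT_iff [IsUltrametricDist 𝕂] (M : Matrix (Fin r) (Fin r) (PowerSeries 𝕂)) :
    MT M ↔ M ∈ (PowerSeries.IsRestricted.subring (R := 𝕂) 1).matrix := by
  simp only [MT, isTate_iff]
  rfl

theorem mnorm_le {M : Matrix (Fin r) (Fin r) (PowerSeries 𝕂)} {c : ℝ} (hc : 0 ≤ c)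
    (h : MB c M) : mnorm 𝕂 M ≤ c :=
  Real.iSup_le (fun p => Real.iSup_le (fun k => h p.1 p.2 k) hc) hc

theorem mnorm_nonneg (M : Matrix (Fin r) (Fin r) (PowerSeries 𝕂)) : 0 ≤ mnorm 𝕂 M :=
  Real.iSup_nonneg fun _ => Real.iSup_nonneg fun _ => norm_nonneg _

theorem MB_mnorm {M : Matrix (Fin r) (Fin r) (PowerSeries 𝕂)} (h : MT M) :
    MB (mnorm 𝕂 M) M := by
  intro i j k
  have h1 : BddAbove (Set.range fun k => ‖PowerSeries.coeff k (M i j)‖) :=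
    (h i j).bddAbove_range
  refine (le_ciSup h1 k).trans ?_
  exact le_ciSup (f := fun p : Fin r × Fin r => gnorm 𝕂 (M p.1 p.2))
    (Set.finite_range _).bddAbove (i, j)

theorem MB.mono {M : Matrix (Fin r) (Fin r) (PowerSeries 𝕂)} {a b : ℝ} (h : MB a M)
    (hab : a ≤ b) : MB b M := fun i j k => (h i j k).trans hab

theorem MB.add [IsUltrametricDist 𝕂] {M N : Matrix (Fin r) (Fin r) (PowerSeries 𝕂)} {a : ℝ}
    (hM : MB a M) (hN : MB a N) : MB a (M + N) := fun i j k => by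
  simp only [Matrix.add_apply, map_add]
  exact (IsUltrametricDist.norm_add_le_max _ _).trans (max_le (hM i j k) (hN i j k))

theorem MB.neg {M : Matrix (Fin r) (Fin r) (PowerSeries 𝕂)} {a : ℝ}
    (hM : MB a M) : MB a (-M) := fun i j k => by
  simpa using hM i j k

theorem MB.sub [IsUltrametricDist 𝕂] {M N : Matrix (Fin r) (Fin r) (PowerSeries 𝕂)} {a : ℝ}
    (hM : MB a M) (hN : MB a N) : MB a (M - N) := by
  rw [sub_eq_add_neg]; exact hM.add hN.neg

theorem MB.mul [IsUltrametricDist 𝕂] {M N : Matrix (Fin r) (Fin r) (PowerSeries 𝕂)} {a b : ℝ}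
    (ha : 0 ≤ a) (hb : 0 ≤ b) (hM : MB a M) (hN : MB b N) : MB (a * b) (M * N) := fun i j k => by
  have h0 : 0 ≤ a * b := mul_nonneg ha hb
  simp only [Matrix.mul_apply, map_sum, PowerSeries.coeff_mul]
  refine IsUltrametricDist.norm_sum_le_of_forall_le_of_nonneg h0 fun l _ => ?_
  refine IsUltrametricDist.norm_sum_le_of_forall_le_of_nonneg h0 fun x _ => ?_
  rw [norm_mul]
  exact mul_le_mul (hM _ _ _) (hN _ _ _) (norm_nonneg _) ha

theorem MB_one : MB 1 (1 : Matrix (Fin r) (Fin r) (PowerSeries 𝕂)) := fun i j k => by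
  rw [Matrix.one_apply]
  split_ifs
  · rw [PowerSeries.coeff_one]
    split_ifs <;> simp
  · simp

theorem MB.pow [IsUltrametricDist 𝕂] {M : Matrix (Fin r) (Fin r) (PowerSeries 𝕂)} {a : ℝ}
    (ha : 0 ≤ a) (hM : MB a M) (n : ℕ) : MB (a ^ n) (M ^ n) := by
  induction n with
  | zero => simpa using MB_one
  | succ n ih => rw [pow_succ, pow_succ]; exact ih.mul (pow_nonneg ha n) ha hM

theorem scalar_lim [IsUltrametricDist 𝕂] [CompleteSpace 𝕂] {ε : ℝ} (h0 : 0 ≤ ε) (h1 : ε < 1)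
    (s : ℕ → 𝕂) (hs : ∀ n, ‖s (n + 1) - s n‖ ≤ ε ^ (n + 1)) :
    ∃ a, ∀ n, ‖s n - a‖ ≤ ε ^ (n + 1) := by
  have hc : CauchySeq s := by
    refine cauchySeq_of_le_geometric ε ε h1 fun n => ?_
    rw [dist_comm, dist_eq_norm, ← pow_succ']
    exact hs n
  obtain ⟨a, ha⟩ := cauchySeq_tendsto_of_complete hc
  refine ⟨a, fun n => ?_⟩
  have key : ∀ m, ‖s n - s (n + m)‖ ≤ ε ^ (n + 1) := by
    intro m
    induction m with
    | zero => simpa using pow_nonneg h0 _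
    | succ m ih =>
      have e : s n - s (n + (m + 1)) = (s n - s (n + m)) + -(s (n + m + 1) - s (n + m)) := by
        rw [← add_assoc]; ring
      rw [e]
      refine (IsUltrametricDist.norm_add_le_max _ _).trans (max_le ih ?_)
      rw [norm_neg]
      exact (hs _).trans (pow_le_pow_of_le_one h0 h1.le (by omega))
  have ht : Tendsto (fun m => ‖s n - s (n + m)‖) atTop (nhds ‖s n - a‖) := by
    have := ha.comp (tendsto_add_atTop_nat n)
    refine (tendsto_const_nhds.sub ?_).norm
    exact this.congr fun m => by simp [add_comm]
  exact le_of_tendsto' ht key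

theorem matrix_lim [IsUltrametricDist 𝕂] [CompleteSpace 𝕂] {ε : ℝ} (h0 : 0 ≤ ε) (h1 : ε < 1)
    (S : ℕ → Matrix (Fin r) (Fin r) (PowerSeries 𝕂)) (hT : ∀ n, MT (S n))
    (hS : ∀ n, MB (ε ^ (n + 1)) (S (n + 1) - S n)) :
    ∃ P, MT P ∧ ∀ n, MB (ε ^ (n + 1)) (S n - P) := by
  choose a ha using fun i j k => scalar_lim h0 h1 (fun n => PowerSeries.coeff k (S n i j))
    (fun n => by simpa using hS n i j k)
  refine ⟨Matrix.of fun i j => PowerSeries.mk (a i j), ?_, fun n i j k => ?_⟩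
  · intro i j
    rw [IsTate, Metric.tendsto_atTop]
    intro δ hδ
    obtain ⟨n, hn⟩ := exists_pow_lt_of_lt_one hδ h1
    obtain ⟨K, hK⟩ := (Metric.tendsto_atTop.mp (hT n i j)) δ hδ
    refine ⟨K, fun k hk => ?_⟩
    have h2 := hK k hk
    have h3 : ‖PowerSeries.coeff k (S n i j) - a i j k‖ < δ :=
      ((ha i j k n).trans (pow_le_pow_of_le_one h0 h1.le (Nat.le_succ n))).trans_lt hn
    simp only [dist_zero_right, norm_norm, Matrix.of_apply, PowerSeries.coeff_mk] at h2 ⊢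
    have e : a i j k = PowerSeries.coeff k (S n i j) +
      -(PowerSeries.coeff k (S n i j) - a i j k) := by ring
    rw [e]
    refine (IsUltrametricDist.norm_add_le_max _ _).trans_lt (max_lt h2 ?_)
    rwa [norm_neg]
  · simpa using ha i j k n

theorem eq_zero_of_MB {ε : ℝ} (h0 : 0 ≤ ε) (h1 : ε < 1)
    {M : Matrix (Fin r) (Fin r) (PowerSeries 𝕂)} (h : ∀ n : ℕ, MB (ε ^ (n + 1)) M) : M = 0 := by
  ext i j k
  have ht : Tendsto (fun n : ℕ => ε ^ (n + 1)) atTop (nhds 0) :=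
    (tendsto_pow_atTop_nhds_zero_of_lt_one h0 h1).comp (tendsto_add_atTop_nat 1)
  have := ge_of_tendsto' ht fun n => h n i j k
  simpa using this

theorem MT.add [IsUltrametricDist 𝕂] {M N : Matrix (Fin r) (Fin r) (PowerSeries 𝕂)}
    (hM : MT M) (hN : MT N) : MT (M + N) := by
  rw [MT_iff] at *; exact add_mem hM hN

theorem MT.sub [IsUltrametricDist 𝕂] {M N : Matrix (Fin r) (Fin r) (PowerSeries 𝕂)}
    (hM : MT M) (hN : MT N) : MT (M - N) := by
  rw [MT_iff] at *; exact sub_mem hM hN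

theorem MT.mul [IsUltrametricDist 𝕂] {M N : Matrix (Fin r) (Fin r) (PowerSeries 𝕂)}
    (hM : MT M) (hN : MT N) : MT (M * N) := by
  rw [MT_iff] at *; exact mul_mem hM hN

theorem MT.pow [IsUltrametricDist 𝕂] {M : Matrix (Fin r) (Fin r) (PowerSeries 𝕂)}
    (hM : MT M) (n : ℕ) : MT (M ^ n) := by
  rw [MT_iff] at *; exact pow_mem hM n

theorem MT_one [IsUltrametricDist 𝕂] : MT (1 : Matrix (Fin r) (Fin r) (PowerSeries 𝕂)) := by
  rw [MT_iff]; exact one_mem _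

theorem MT_sum [IsUltrametricDist 𝕂] {f : ℕ → Matrix (Fin r) (Fin r) (PowerSeries 𝕂)}
    (hM : ∀ n, MT (f n)) (n : ℕ) : MT (∑ k ∈ Finset.range n, f k) := by
  simp only [MT_iff] at *; exact sum_mem fun k _ => hM k

theorem memGLT_of [IsUltrametricDist 𝕂] [CompleteSpace 𝕂] {ε : ℝ} (h0 : 0 ≤ ε) (h1 : ε < 1)
    {P : Matrix (Fin r) (Fin r) (PowerSeries 𝕂)} (hT : MT P) (hP : MB ε (P - 1)) :
    MemGLT 𝕂 P := by
  have hG : MB ε (1 - P) := by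
    rw [← neg_sub]; exact hP.neg
  have hGT : MT (1 - P) := MT_one.sub hT
  obtain ⟨C, hCT, hC⟩ := matrix_lim h0 h1
    (fun n => ∑ k ∈ Finset.range (n + 1), (1 - P) ^ k) (fun n => MT_sum hGT.pow _) (fun n => by
      simp only [Finset.sum_range_succ _ (n + 1), add_sub_cancel_left]
      exact hG.pow h0 _)
  have hP1 : MB 1 P := by
    have := (hP.mono h1.le).add MB_one
    simpa using this
  have hPC : P * C = 1 := by
    rw [← sub_eq_zero]
    refine eq_zero_of_MB h0 h1 fun n => ?_
    have e : P * C - 1 = -(P * ((∑ k ∈ Finset.range (n + 1), (1 - P) ^ k) - C))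
        - (1 - P) ^ (n + 1) := by
      have := mul_neg_geom_sum (1 - P) (n + 1)
      rw [sub_sub_cancel] at this
      rw [mul_sub, this]
      abel
    rw [e]
    refine MB.sub (MB.neg ?_) (hG.pow h0 _)
    simpa using hP1.mul zero_le_one (pow_nonneg h0 (n + 1)) (hC n)
  exact ⟨hT, C, hCT, hPC, mul_eq_one_comm.mp hPC⟩

theorem twistM_MT {q : ℕ} (hq : q ≠ 0) {M : Matrix (Fin r) (Fin r) (PowerSeries 𝕂)}
    (hM : MT M) (n : ℕ) : MT (twistM 𝕂 q n M) := by
  intro i j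
  have h := (hM i j).pow (q ^ n)
  rw [zero_pow (pow_ne_zero n hq)] at h
  simpa [IsTate, twistM, twist] using h

theorem mnorm_twistM {q : ℕ} (hq : q ≠ 0) {M : Matrix (Fin r) (Fin r) (PowerSeries 𝕂)}
    (hM : MT M) (n : ℕ) : mnorm 𝕂 (twistM 𝕂 q n M) = mnorm 𝕂 M ^ q ^ n := by
  have hN : q ^ n ≠ 0 := pow_ne_zero n hq
  apply le_antisymm
  · refine mnorm_le (pow_nonneg (mnorm_nonneg _) _) fun i j k => ?_
    simp only [twistM, twist, Matrix.of_apply, PowerSeries.coeff_mk, norm_pow]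
    exact pow_le_pow_left₀ (norm_nonneg _) (MB_mnorm hM i j k) _
  · set δ := mnorm 𝕂 (twistM 𝕂 q n M) with hδ
    have hδ0 : 0 ≤ δ := mnorm_nonneg _
    have hroot : (δ ^ (((q ^ n : ℕ) : ℝ)⁻¹)) ^ (q ^ n) = δ := Real.rpow_inv_natCast_pow hδ0 hN
    have hr0 : 0 ≤ δ ^ (((q ^ n : ℕ) : ℝ)⁻¹) := Real.rpow_nonneg hδ0 _
    conv_rhs => rw [← hroot]
    refine pow_le_pow_left₀ (mnorm_nonneg _) (mnorm_le hr0 fun i j k => ?_) _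
    refine le_of_pow_le_pow_left₀ hN hr0 ?_
    rw [hroot]
    have := MB_mnorm (twistM_MT hq hM n) i j k
    rw [← hδ] at this
    have e : PowerSeries.coeff k (twistM 𝕂 q n M i j) =
        PowerSeries.coeff k (M i j) ^ q ^ n := by
      simp only [twistM, twist, Matrix.of_apply, PowerSeries.coeff_mk]
    rwa [e, norm_pow] at this

theorem twistM_sub_one {p e : ℕ} [Fact p.Prime] [CharP 𝕂 p]
    (M : Matrix (Fin r) (Fin r) (PowerSeries 𝕂)) (n : ℕ) :
    twistM 𝕂 (p ^ e) n M - 1 = twistM 𝕂 (p ^ e) n (M - 1) := by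
  have hp : p ≠ 0 := (Fact.out : p.Prime).ne_zero
  have hN : (p ^ e) ^ n ≠ 0 := pow_ne_zero _ (pow_ne_zero _ hp)
  ext i j k
  simp only [twistM, twist, Matrix.of_apply, PowerSeries.coeff_mk, Matrix.sub_apply, map_sub]
  rw [← pow_mul, sub_pow_char_pow, Matrix.one_apply]
  rw [← pow_mul] at hN
  congr 1
  split_ifs
  · rw [PowerSeries.coeff_one]
    split_ifs
    · rw [one_pow]
    · rw [zero_pow hN]
  · rw [map_zero, zero_pow hN]

end helpers

theorem stmt19
    (𝕂 : Type) [NontriviallyNormedField 𝕂] [CompleteSpace 𝕂] [IsAlgClosed 𝕂]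
    (hna : ∀ x y : 𝕂, ‖x + y‖ ≤ max ‖x‖ ‖y‖)
    (p e q : ℕ) (hp : p.Prime) (hcharp : CharP 𝕂 p) (he : 0 < e) (hqpe : q = p ^ e)
    (θ : 𝕂) (hθ : ‖θ‖ = (q : ℝ))
    (r : ℕ) (hr : 0 < r) (A : ℕ → 𝕂) (hAr : A r ≠ 0)
    (F : Matrix (Fin r) (Fin r) (PowerSeries 𝕂))
    (hFT : ∀ i j, IsTate 𝕂 (F i j))
    (hF : mnorm 𝕂 (F - 1) < 1) :
    (∀ n : ℕ, mnorm 𝕂 (twistM 𝕂 q n F - 1) = mnorm 𝕂 (F - 1) ^ q ^ n) ∧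
    Tendsto (fun n => mnorm 𝕂 (twistM 𝕂 q n F - 1)) atTop (nhds 0) ∧
    ∃ P : Matrix (Fin r) (Fin r) (PowerSeries 𝕂),
      MTendsto 𝕂 (fun n => prodTwists 𝕂 q F n) P ∧ MemGLT 𝕂 P := by
  have : IsUltrametricDist 𝕂 :=
    IsUltrametricDist.isUltrametricDist_of_forall_norm_add_le_max_norm hna
  have : Fact p.Prime := ⟨hp⟩
  have := hcharp
  have hq0 : q ≠ 0 := by rw [hqpe]; exact pow_ne_zero _ hp.ne_zero
  have hq1 : 1 < q := by rw [hqpe]; exact Nat.one_lt_pow he.ne' hp.one_lt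
  have hFT' : MT F := hFT
  have hGT : MT (F - 1) := hFT'.sub MT_one
  have H1 : ∀ n : ℕ, mnorm 𝕂 (twistM 𝕂 q n F - 1) = mnorm 𝕂 (F - 1) ^ q ^ n := by
    intro n
    rw [← mnorm_twistM hq0 hGT n, hqpe, twistM_sub_one]
  set ε := mnorm 𝕂 (F - 1) with hε
  have h0 : 0 ≤ ε := mnorm_nonneg _
  have hlim : Tendsto (fun n : ℕ => ε ^ n) atTop (nhds 0) :=
    tendsto_pow_atTop_nhds_zero_of_lt_one h0 hF
  have hTn : ∀ n, MT (twistM 𝕂 q n F) := twistM_MT hq0 hFT'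
  have hBn : ∀ n, MB (ε ^ q ^ n) (twistM 𝕂 q n F - 1) := fun n => by
    rw [← H1 n]; exact MB_mnorm ((hTn n).sub MT_one)
  have hBn1 : ∀ n, MB 1 (twistM 𝕂 q n F) := fun n => by
    have := ((hBn n).mono (pow_le_one₀ h0 hF.le)).add MB_one
    simpa using this
  have hsucc : ∀ n, prodTwists 𝕂 q F (n + 1) = prodTwists 𝕂 q F n * twistM 𝕂 q (n + 1) F := by
    intro n
    simp only [prodTwists]
    rw [List.range_succ (n := n + 1), List.map_append, List.prod_append]
    simp
  have hzero : prodTwists 𝕂 q F 0 = twistM 𝕂 q 0 F := by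
    simp [prodTwists]
  have hPT : ∀ n, MT (prodTwists 𝕂 q F n) := by
    intro n
    induction n with
    | zero => rw [hzero]; exact hTn 0
    | succ n ih => rw [hsucc]; exact ih.mul (hTn _)
  have hP1 : ∀ n, MB 1 (prodTwists 𝕂 q F n) := by
    intro n
    induction n with
    | zero => rw [hzero]; exact hBn1 0
    | succ n ih =>
      rw [hsucc]
      simpa using ih.mul zero_le_one zero_le_one (hBn1 (n + 1))
  refine ⟨H1, ?_, ?_⟩
  · simp only [H1]
    exact hlim.comp (tendsto_pow_atTop_atTop_of_one_lt hq1)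
  · obtain ⟨P, hT, hP⟩ := matrix_lim h0 hF (fun n => prodTwists 𝕂 q F n) hPT (fun n => by
      have e : prodTwists 𝕂 q F (n + 1) - prodTwists 𝕂 q F n =
          prodTwists 𝕂 q F n * (twistM 𝕂 q (n + 1) F - 1) := by
        rw [hsucc, mul_sub, mul_one]
      rw [e]
      have h2 := (hP1 n).mul zero_le_one (pow_nonneg h0 _) (hBn (n + 1))
      rw [one_mul] at h2
      exact h2.mono (pow_le_pow_of_le_one h0 hF.le (Nat.lt_pow_self hq1).le))
    refine ⟨P, ?_, ?_⟩
    · refine squeeze_zero (fun n => mnorm_nonneg _)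
        (fun n => mnorm_le (pow_nonneg h0 (n + 1)) (hP n)) ?_
      exact hlim.comp (tendsto_add_atTop_nat 1)
    · refine memGLT_of h0 hF hT ?_
      have e : P - 1 = (twistM 𝕂 q 0 F - 1) - (prodTwists 𝕂 q F 0 - P) := by
        rw [hzero]; abel
      rw [e]
      refine MB.sub ?_ ?_
      · simpa using hBn 0
      · simpa using hP 0

end DrinfeldRAT
end
end
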